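/- Let n ≥ 3 and 2 ≤ k ≤ n−1, and let W¹, W², W³, …, W^k be real symmetric (n−1)×(n−1) matrices such that each W^i lies in the Gårding cone Γ_k or in −Γ_k. Then σ_{(k)}(W¹, W², W³, …, W^k)² ≥ σ_{(k)}(W¹, W¹, W³, …, W^k) · σ_{(k)}(W², W², W³, …, W^k), and equality holds if and only if W¹ and W² are scalar multiples of each other, i.e. W² = c·W¹ for some nonzero real number c. -/

import Mathlib

open Matrix

/-- `sigmaM k W` is the `k`-th elementary symmetric function of (the eigenvalues of) `W`,
defined as the coefficient of `x^k` in `det (I + x • W)`. -/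
noncomputable def sigmaM {m : ℕ} {R : Type*} [CommRing R] (k : ℕ)
    (W : Matrix (Fin m) (Fin m) R) : R :=
  ((1 + (Polynomial.X : Polynomial R) • W.map Polynomial.C).det).coeff k

/-- The mixed higher order mean curvature `P_{r,s}(χ, χ̄)`, defined as
`(r! s! / (r+s)!)` times the coefficient of `y^r ȳ^s` in `det (I + y • χ + ȳ • χ̄)`. -/
noncomputable def mixedP {m : ℕ} (r s : ℕ) (χ χb : Matrix (Fin m) (Fin m) ℝ) : ℝ :=
  ((Nat.factorial r * Nat.factorial s : ℝ) / (Nat.factorial (r + s) : ℝ)) *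
    ((((1 : Matrix (Fin m) (Fin m) (Polynomial (Polynomial ℝ)))
        + (Polynomial.X : Polynomial (Polynomial ℝ)) •
            χ.map (fun a => Polynomial.C (Polynomial.C a))
        + (Polynomial.C Polynomial.X : Polynomial (Polynomial ℝ)) •
            χb.map (fun a => Polynomial.C (Polynomial.C a))).det).coeff r).coeff s

/-- A real symmetric matrix lies in the Gårding cone `Γ_k` iff the elementary symmetric
functions `σ_1, …, σ_k` of its eigenvalues are all positive. -/
def matGamma {m : ℕ} (k : ℕ) (W : Matrix (Fin m) (Fin m) ℝ) : Prop :=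
  ∀ j : ℕ, 1 ≤ j → j ≤ k → 0 < sigmaM j W

/-- The complete polarization `σ_{(k)}(W¹, …, W^k)`: `(1/k!)` times the coefficient of
the monomial `t₁ t₂ ⋯ t_k` in `σ_k (t₁ • W¹ + ⋯ + t_k • W^k)`. -/
noncomputable def polarMat {m k : ℕ} (W : Fin k → Matrix (Fin m) (Fin m) ℝ) : ℝ :=
  (1 / (Nat.factorial k : ℝ)) *
    MvPolynomial.coeff (∑ i : Fin k, Finsupp.single i 1)
      (sigmaM k (∑ i : Fin k,
        (MvPolynomial.X i : MvPolynomial (Fin k) ℝ) • (W i).map MvPolynomial.C))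

open Finset in
/-- sum over row-subsets of a given size -/
noncomputable def pwDet {m : ℕ} {R : Type*} [CommRing R] (W : Matrix (Fin m) (Fin m) R)
    (S : Finset (Fin m)) : R :=
  (Matrix.of (S.piecewise (fun i => W i) (fun i => (1 : Matrix (Fin m) (Fin m) R) i))).det

lemma det_lin {m : ℕ} {R : Type*} [CommRing R] (W : Matrix (Fin m) (Fin m) R) (a b : R) :
    (a • (1 : Matrix (Fin m) (Fin m) R) + b • W).det
      = ∑ S : Finset (Fin m), b ^ S.card * a ^ (m - S.card) * pwDet W S := by
  have h1 : (a • (1 : Matrix (Fin m) (Fin m) R) + b • W).det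
      = (Matrix.detRowAlternating (n := Fin m) (R := R)).toMultilinearMap
        ((fun i => b • W i) + (fun i => a • (1 : Matrix (Fin m) (Fin m) R) i)) := by
    rw [add_comm]; rfl
  rw [h1, MultilinearMap.map_add_univ]
  refine Finset.sum_congr rfl fun S _ => ?_
  have h2 : S.piecewise (fun i => b • W i) (fun i => a • (1 : Matrix (Fin m) (Fin m) R) i)
      = fun i => (S.piecewise (fun _ => b) (fun _ => a) i) •
        (S.piecewise (fun i => W i) (fun i => (1 : Matrix (Fin m) (Fin m) R) i)) i := by
    funext i
    by_cases h : i ∈ S <;> simp [h]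
  rw [h2, MultilinearMap.map_smul_univ, smul_eq_mul]
  congr 1
  rw [Finset.prod_piecewise]
  simp [Finset.card_sdiff, Finset.inter_univ]

lemma pwDet_map {m : ℕ} {R R' : Type*} [CommRing R] [CommRing R'] (φ : R →+* R')
    (W : Matrix (Fin m) (Fin m) R) (S : Finset (Fin m)) :
    pwDet (W.map φ) S = φ (pwDet W S) := by
  unfold pwDet
  rw [RingHom.map_det]
  congr 1
  ext i j
  by_cases h : i ∈ S <;> simp [h, Matrix.one_apply, apply_ite φ]

lemma sigmaM_eq {m : ℕ} {R : Type*} [CommRing R] (W : Matrix (Fin m) (Fin m) R) (j : ℕ) :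
    sigmaM j W = ∑ S : Finset (Fin m) with S.card = j, pwDet W S := by
  unfold sigmaM
  have := det_lin (W.map Polynomial.C) (1 : Polynomial R) Polynomial.X
  rw [one_smul] at this
  rw [this, Polynomial.finsetSum_coeff, Finset.sum_filter]
  refine Finset.sum_congr rfl fun S _ => ?_
  rw [pwDet_map, one_pow, mul_one, mul_comm, Polynomial.coeff_C_mul, Polynomial.coeff_X_pow]
  simp [eq_comm]

lemma sigmaM_map {m : ℕ} {R R' : Type*} [CommRing R] [CommRing R'] (φ : R →+* R')
    (W : Matrix (Fin m) (Fin m) R) (j : ℕ) :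
    sigmaM j (W.map φ) = φ (sigmaM j W) := by
  simp only [sigmaM_eq, map_sum, pwDet_map]

lemma sigmaM_zero {m : ℕ} {R : Type*} [CommRing R] (W : Matrix (Fin m) (Fin m) R) :
    sigmaM 0 W = 1 := by
  rw [sigmaM_eq]
  have : (Finset.univ.filter fun S : Finset (Fin m) => S.card = 0) = {∅} := by
    ext S; simp
  rw [this, Finset.sum_singleton]
  unfold pwDet
  simp only [Finset.piecewise_empty]
  exact Matrix.det_one

lemma det_lin' {m : ℕ} {R : Type*} [CommRing R] (W : Matrix (Fin m) (Fin m) R) (a b : R) :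
    (a • (1 : Matrix (Fin m) (Fin m) R) + b • W).det
      = ∑ j ∈ Finset.range (m + 1), b ^ j * a ^ (m - j) * sigmaM j W := by
  rw [det_lin]
  have := Finset.sum_fiberwise_of_maps_to (s := (Finset.univ : Finset (Finset (Fin m))))
    (t := Finset.range (m+1)) (g := fun S => S.card) (fun S _ => by
      have := Finset.card_le_univ S
      simp at this ⊢; omega) (fun S => b ^ S.card * a ^ (m - S.card) * pwDet W S)
  rw [← this]
  refine Finset.sum_congr rfl fun j _ => ?_
  rw [sigmaM_eq, Finset.mul_sum]
  refine Finset.sum_congr rfl fun S hS => ?_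
  simp at hS
  rw [hS]

/-- coefficient expansion of `σ_k (tI + sW)` -/
lemma sigmaM_add {m : ℕ} {R : Type*} [CommRing R] (W : Matrix (Fin m) (Fin m) R) (t s : R)
    (k : ℕ) (hk : k ≤ m) :
    sigmaM k (t • (1 : Matrix (Fin m) (Fin m) R) + s • W)
      = ∑ j ∈ Finset.range (k + 1), ((m - j).choose (k - j) : R) * t ^ (k - j) * s ^ j *
          sigmaM j W := by
  have h0 : sigmaM k (t • (1 : Matrix (Fin m) (Fin m) R) + s • W)
      = (((1 + Polynomial.X * Polynomial.C t) • (1 : Matrix (Fin m) (Fin m) (Polynomial R))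
        + (Polynomial.X * Polynomial.C s) • W.map Polynomial.C).det).coeff k := by
    unfold sigmaM
    congr 2
    ext i j : 1
    by_cases h : i = j
    · subst h; simp; ring
    · simp [h]; ring
  rw [h0, det_lin', Polynomial.finsetSum_coeff]
  have h1 : ∀ j ∈ Finset.range (m+1),
      ((Polynomial.X * Polynomial.C s) ^ j * (1 + Polynomial.X * Polynomial.C t) ^ (m - j) *
        sigmaM j (W.map Polynomial.C)).coeff k =
      if j ≤ k then ((m - j).choose (k - j) : R) * t ^ (k - j) * s ^ j *
          sigmaM j W else 0 := by
    intro j hj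
    rw [sigmaM_map, mul_pow, ← Polynomial.C_pow]
    have e1 : (Polynomial.X ^ j * Polynomial.C (s^j) * (1 + Polynomial.X * Polynomial.C t) ^ (m - j)
      * Polynomial.C (sigmaM j W)) =
      Polynomial.C (s^j * sigmaM j W) * ((1 + Polynomial.X * Polynomial.C t) ^ (m - j)
        * Polynomial.X ^ j) := by
      rw [Polynomial.C_mul]; ring
    rw [e1, Polynomial.coeff_C_mul, Polynomial.coeff_mul_X_pow']
    split_ifs with h
    · have e2 : (1 + Polynomial.X * Polynomial.C t : Polynomial R) ^ (m-j) =
        ((1 + Polynomial.X : Polynomial R) ^ (m-j)).comp (Polynomial.C t * Polynomial.X) := by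
        rw [mul_comm]; simp
      rw [e2, Polynomial.comp_C_mul_X_coeff, Polynomial.coeff_one_add_X_pow]
      ring
    · simp
  rw [Finset.sum_congr rfl h1, ← Finset.sum_filter]
  refine Finset.sum_congr ?_ fun _ _ => rfl
  ext j; simp; omega

lemma sigmaM_smul {m : ℕ} {R : Type*} [CommRing R] (W : Matrix (Fin m) (Fin m) R) (s : R)
    (k : ℕ) (hk : k ≤ m) : sigmaM k (s • W) = s ^ k * sigmaM k W := by
  have := sigmaM_add W 0 s k hk
  rw [zero_smul, zero_add] at this
  rw [this, Finset.sum_eq_single k]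
  · simp
  · intro j hj hne
    have : k - j ≠ 0 := by simp at hj; omega
    simp [this]
  · simp

/-! ### The polarization as a multilinear map -/

/-- admissible row assignments -/
def goodC {m k : ℕ} (c : Fin m → Option (Fin k)) : Prop :=
  ∀ a : Fin k, (Finset.univ.filter fun i => c i = some a).card = 1

/-- rows chosen according to `c` -/
def rowC {m k : ℕ} {R : Type*} [CommRing R] (Z : Fin k → Matrix (Fin m) (Fin m) R)
    (c : Fin m → Option (Fin k)) : Matrix (Fin m) (Fin m) R :=
  Matrix.of fun i => (c i).elim ((1 : Matrix (Fin m) (Fin m) R) i) (fun a => Z a i)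

open Classical in
/-- `k!` times the polarization -/
noncomputable def MR {m k : ℕ} {R : Type*} [CommRing R]
    (Z : Fin k → Matrix (Fin m) (Fin m) R) : R :=
  ∑ c : Fin m → Option (Fin k) with goodC c, (rowC Z c).det

lemma goodC_exists {m k : ℕ} {c : Fin m → Option (Fin k)} (h : goodC c) (a : Fin k) :
    ∃ i, ∀ i', c i' = some a ↔ i' = i := by
  obtain ⟨i, hi⟩ := Finset.card_eq_one.1 (h a)
  refine ⟨i, fun i' => ?_⟩
  have := Finset.ext_iff.1 hi i'
  simpa using this

lemma rowC_update {m k : ℕ} {R : Type*} [CommRing R] (Z : Fin k → Matrix (Fin m) (Fin m) R)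
    (c : Fin m → Option (Fin k)) (a : Fin k) (i : Fin m) (hi : ∀ i', c i' = some a ↔ i' = i)
    (x : Matrix (Fin m) (Fin m) R) :
    rowC (Function.update Z a x) c = (rowC Z c).updateRow i (x i) := by
  ext i' j
  by_cases h : i' = i
  · subst h
    have := (hi i').2 rfl
    simp [rowC, this]
  · rw [Matrix.updateRow_ne h]
    have h' := fun h2 => h ((hi i').1 h2)
    simp only [rowC, Matrix.of_apply]
    cases hc : c i' with
    | none => simp
    | some b =>
      have : b ≠ a := by rintro rfl; exact h' hc
      simp [this]

/-- `MR` as a multilinear map -/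
noncomputable def MM (m k : ℕ) (R : Type*) [CommRing R] :
    MultilinearMap R (fun _ : Fin k => Matrix (Fin m) (Fin m) R) R where
  toFun := MR
  map_update_add' := by
    intro inst Z a x y
    have : inst = instDecidableEqFin k := Subsingleton.elim _ _
    subst this
    classical
    unfold MR
    rw [← Finset.sum_add_distrib]
    refine Finset.sum_congr rfl fun c hc => ?_
    obtain ⟨i, hi⟩ := goodC_exists (Finset.mem_filter.1 hc).2 a
    rw [rowC_update _ _ _ _ hi, rowC_update _ _ _ _ hi, rowC_update _ _ _ _ hi]
    exact Matrix.det_updateRow_add _ _ _ _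
  map_update_smul' := by
    intro inst Z a s x
    have : inst = instDecidableEqFin k := Subsingleton.elim _ _
    subst this
    classical
    unfold MR
    rw [Finset.smul_sum]
    refine Finset.sum_congr rfl fun c hc => ?_
    obtain ⟨i, hi⟩ := goodC_exists (Finset.mem_filter.1 hc).2 a
    rw [rowC_update _ _ _ _ hi, rowC_update _ _ _ _ hi]
    exact Matrix.det_updateRow_smul _ _ _ _

lemma MM_apply {m k : ℕ} {R : Type*} [CommRing R] (Z : Fin k → Matrix (Fin m) (Fin m) R) :
    MM m k R Z = MR Z := rfl

lemma MR_map {m k : ℕ} {R R' : Type*} [CommRing R] [CommRing R'] (φ : R →+* R')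
    (Z : Fin k → Matrix (Fin m) (Fin m) R) :
    MR (fun a => (Z a).map φ) = φ (MR Z) := by
  unfold MR
  rw [map_sum]
  refine Finset.sum_congr rfl fun c _ => ?_
  rw [RingHom.map_det]
  congr 1
  ext i j
  cases h : c i <;> simp [rowC, h, Matrix.one_apply, apply_ite φ]

lemma MR_perm {m k : ℕ} {R : Type*} [CommRing R] (Z : Fin k → Matrix (Fin m) (Fin m) R)
    (π : Equiv.Perm (Fin k)) : MR (fun a => Z (π a)) = MR Z := by
  classical
  unfold MR
  refine Finset.sum_bij' (fun c _ => fun i => (c i).map π) (fun c _ => fun i => (c i).map π.symm)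
    ?_ ?_ ?_ ?_ ?_
  · intro c hc
    simp only [Finset.mem_filter, Finset.mem_univ, true_and] at hc ⊢
    intro a
    rw [← hc (π.symm a)]
    congr 1
    ext i
    simp only [Finset.mem_filter, Finset.mem_univ, true_and]
    cases c i <;> simp [Equiv.eq_symm_apply]
  · intro c hc
    simp only [Finset.mem_filter, Finset.mem_univ, true_and] at hc ⊢
    intro a
    rw [← hc (π a)]
    congr 1
    ext i
    simp only [Finset.mem_filter, Finset.mem_univ, true_and]
    cases c i <;> simp [Equiv.symm_apply_eq]
  · intro c _; funext i; simp
  · intro c _; funext i; simp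
  · intro c _
    congr 1
    ext i j
    cases h : c i <;> simp [rowC, h]

lemma sum_single_apply {ι : Type*} [Fintype ι] {k : ℕ} (c : ι → Option (Fin k)) (a : Fin k) :
    (∑ i, (c i).elim 0 (fun b => Finsupp.single b 1) : Fin k →₀ ℕ) a
      = (Finset.univ.filter fun i => c i = some a).card := by
  classical
  rw [Finsupp.finsetSum_apply, Finset.card_filter]
  refine Finset.sum_congr rfl fun i _ => ?_
  cases h : c i <;> simp [Finsupp.single_apply]

lemma ones_apply {k : ℕ} (a : Fin k) : (∑ i : Fin k, Finsupp.single i 1 : Fin k →₀ ℕ) a = 1 := by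
  rw [Finsupp.finsetSum_apply]
  simp [Finsupp.single_apply]

lemma goodC_iff {m k : ℕ} (c : Fin m → Option (Fin k)) : goodC c ↔
    (∑ i, (c i).elim 0 (fun b => Finsupp.single b 1) : Fin k →₀ ℕ) =
      ∑ i : Fin k, Finsupp.single i 1 := by
  rw [Finsupp.ext_iff]
  simp only [sum_single_apply, ones_apply]
  rfl

lemma goodC_card {m k : ℕ} (c : Fin m → Option (Fin k)) (h : goodC c) :
    (∑ i, (c i).elim 0 (fun _ => 1) : ℕ) = k := by
  have h1 : ∀ i, (c i).elim 0 (fun _ => 1) = ∑ a : Fin k, if c i = some a then 1 else 0 := by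
    intro i
    cases h : c i <;> simp
  simp only [h1]
  rw [Finset.sum_comm]
  have : ∀ a, (∑ i, if c i = some a then 1 else 0 : ℕ) = 1 := fun a => by
    rw [← Finset.card_filter]; exact h a
  simp [this]

lemma coeff_eq_MR {m k : ℕ} {R : Type*} [CommRing R] (W : Fin k → Matrix (Fin m) (Fin m) R) :
    MvPolynomial.coeff (∑ i : Fin k, Finsupp.single i 1)
      (sigmaM k (∑ i : Fin k,
        (MvPolynomial.X i : MvPolynomial (Fin k) R) • (W i).map MvPolynomial.C)) = MR W := by
  classical
  set φ : R →+* Polynomial (MvPolynomial (Fin k) R) :=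
    Polynomial.C.comp MvPolynomial.C with hφ
  let q : Option (Fin k) → Polynomial (MvPolynomial (Fin k) R) :=
    fun o => o.elim 1 (fun a => Polynomial.X * Polynomial.C (MvPolynomial.X a))
  let V : Option (Fin k) → Matrix (Fin m) (Fin m) (Polynomial (MvPolynomial (Fin k) R)) :=
    fun o => o.elim 1 (fun a => (W a).map φ)
  have h1 : (1 + (Polynomial.X : Polynomial (MvPolynomial (Fin k) R)) •
      (∑ i : Fin k, (MvPolynomial.X i : MvPolynomial (Fin k) R) •
        (W i).map MvPolynomial.C).map Polynomial.C).det
      = (Matrix.detRowAlternating (n := Fin m)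
          (R := Polynomial (MvPolynomial (Fin k) R))).toMultilinearMap
        (fun i => ∑ o : Option (Fin k), q o • V o i) := by
    change Matrix.det _ = Matrix.det _
    congr 1
    ext i j : 1
    rw [Fintype.sum_option]
    simp [q, V, hφ, Matrix.sum_apply, Finset.mul_sum, mul_assoc]
    refine Finset.sum_congr rfl fun a _ => ?_
    ring
  unfold sigmaM
  rw [h1, MultilinearMap.map_sum, Polynomial.finsetSum_coeff, MvPolynomial.coeff_sum]
  unfold MR
  rw [Finset.sum_filter]
  refine Finset.sum_congr rfl fun c _ => ?_
  rw [MultilinearMap.map_smul_univ]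
  have h2 : (Matrix.detRowAlternating (n := Fin m)
          (R := Polynomial (MvPolynomial (Fin k) R))).toMultilinearMap (fun i => V (c i) i)
      = Polynomial.C (MvPolynomial.C (rowC W c).det) := by
    change Matrix.det _ = φ _
    rw [RingHom.map_det]
    congr 1
    ext i j : 1
    cases h : c i <;> simp [V, rowC, h, Matrix.one_apply, apply_ite φ]
  have h3 : ∏ i, q (c i) = Polynomial.C (MvPolynomial.monomial
      (∑ i, (c i).elim 0 (fun b => Finsupp.single b 1)) 1) *
      Polynomial.X ^ (∑ i, (c i).elim 0 (fun _ => 1)) := by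
    rw [← Finset.prod_pow_eq_pow_sum, MvPolynomial.monomial_sum_one, map_prod,
      ← Finset.prod_mul_distrib]
    refine Finset.prod_congr rfl fun i _ => ?_
    cases h : c i
    · simp [q]
    · simp only [q, Option.elim, pow_one]
      rw [mul_comm]; rfl
  rw [h2, h3, smul_eq_mul, mul_right_comm, ← Polynomial.C_mul, Polynomial.coeff_C_mul_X_pow]
  by_cases hg : goodC c
  · rw [if_pos (goodC_card c hg).symm, if_pos hg, (goodC_iff c).1 hg, mul_comm,
      MvPolynomial.coeff_C_mul, MvPolynomial.coeff_monomial]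
    simp
  · rw [if_neg hg]
    split_ifs
    · rw [mul_comm, MvPolynomial.coeff_C_mul, MvPolynomial.coeff_monomial, if_neg, mul_zero]
      exact fun h => hg ((goodC_iff c).2 h)
    · simp

lemma polarMat_eq {m k : ℕ} (W : Fin k → Matrix (Fin m) (Fin m) ℝ) :
    polarMat W = (1 / (Nat.factorial k : ℝ)) * MM m k ℝ W := by
  unfold polarMat
  rw [coeff_eq_MR, MM_apply]

lemma coeff_sum_pow {k : ℕ} {R : Type*} [CommRing R] :
    MvPolynomial.coeff (∑ i : Fin k, Finsupp.single i 1)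
      ((∑ i : Fin k, (MvPolynomial.X i : MvPolynomial (Fin k) R)) ^ k) = (k.factorial : R) := by
  classical
  have h1 : (∑ i : Fin k, (MvPolynomial.X i : MvPolynomial (Fin k) R)) ^ k
      = ∑ c : Fin k → Fin k, ∏ j, MvPolynomial.X (c j) := by
    have := Finset.prod_univ_sum (fun _ : Fin k => (Finset.univ : Finset (Fin k)))
      (fun _ i => (MvPolynomial.X i : MvPolynomial (Fin k) R))
    simpa using this
  rw [h1, MvPolynomial.coeff_sum]
  have h2 : ∀ c : Fin k → Fin k, MvPolynomial.coeff (∑ i : Fin k, Finsupp.single i 1)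
      (∏ j, (MvPolynomial.X (c j) : MvPolynomial (Fin k) R)) =
      if Function.Bijective c then 1 else 0 := by
    intro c
    have : (∏ j, (MvPolynomial.X (c j) : MvPolynomial (Fin k) R)) =
      MvPolynomial.monomial (∑ j, Finsupp.single (c j) 1) 1 := by
      rw [MvPolynomial.monomial_sum_one]; rfl
    rw [this, MvPolynomial.coeff_monomial]
    congr 1
    apply propext
    have h3 := goodC_iff (fun j => some (c j))
    simp only [Option.elim] at h3
    rw [← h3]
    constructor
    · intro h
      refine Finite.surjective_iff_bijective.1 fun a => ?_
      obtain ⟨i, hi⟩ := goodC_exists h a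
      exact ⟨i, by simpa using (hi i).2 rfl⟩
    · intro h a
      obtain ⟨i, hi⟩ := h.2 a
      rw [Finset.card_eq_one]
      refine ⟨i, ?_⟩
      ext j
      simp only [Option.some.injEq, Finset.mem_filter, Finset.mem_univ, true_and,
        Finset.mem_singleton]
      exact ⟨fun hj => h.1 (hj.trans hi.symm), fun hj => hj ▸ hi⟩
  rw [Finset.sum_congr rfl fun c _ => h2 c, ← Finset.sum_filter, Finset.sum_const, nsmul_one]
  congr 1
  rw [← Fintype.card_subtype, ← Fintype.card_congr (Equiv.ofBijective (β := {f : Fin k → Fin k // Function.Bijective f}) (fun e : Equiv.Perm (Fin k) => ⟨e, e.bijective⟩) ⟨fun a b h => by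
      ext x; simpa using congrArg (fun z => ((z.1 x : Fin k) : ℕ)) h, fun f => ⟨Equiv.ofBijective f.1 f.2, by ext; simp⟩⟩), Fintype.card_perm, Fintype.card_fin]

lemma MM_diag {m k : ℕ} {R : Type*} [CommRing R] (hk : k ≤ m) (W : Matrix (Fin m) (Fin m) R) :
    MM m k R (fun _ => W) = k.factorial * sigmaM k W := by
  rw [MM_apply, ← coeff_eq_MR, ← Finset.sum_smul, sigmaM_smul _ _ _ hk, sigmaM_map, mul_comm,
    MvPolynomial.coeff_C_mul, coeff_sum_pow, mul_comm]
/-! ### Analytic lemmas -/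

lemma gl_half (P : Polynomial ℂ) (hdeg : 0 < P.degree)
    (h : ∀ z : ℂ, 0 ≤ z.im → P.eval z ≠ 0) (z : ℂ) (hz : 0 ≤ z.im) :
    P.derivative.eval z ≠ 0 := by
  intro h0
  have hd : P.derivative ≠ 0 := by
    intro h1
    have := Polynomial.derivative_eq_zero.1 h1
    rw [← Polynomial.natDegree_pos_iff_degree_pos] at hdeg
    omega
  have hmem : z ∈ P.derivative.rootSet ℂ := by
    rw [Polynomial.mem_rootSet]
    exact ⟨hd, by simpa using h0⟩
  have h2 := Polynomial.rootSet_derivative_subset_convexHull_rootSet hdeg hmem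
  have h3 : convexHull ℝ (P.rootSet ℂ) ⊆ {z : ℂ | z.im < 0} := by
    refine convexHull_min ?_ ?_
    · intro w hw
      rw [Polynomial.mem_rootSet] at hw
      by_contra hc
      exact h w (by simpa using hc) (by simpa using hw.2)
    · exact convex_halfSpace_im_lt 0
  have := h3 h2
  simp at this
  linarith

lemma lower_half (P : Polynomial ℂ) (k : ℕ) (hk : P.natDegree = k)
    (h : ∀ z : ℂ, 0 < z.im → P.eval z ≠ 0) (z : ℂ) (hz : 0 ≤ z.im) :
    ‖P.coeff k‖ * z.im ^ k ≤ ‖P.eval z‖ := by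
  have hs := IsAlgClosed.splits P
  have hc : P.roots.card = k := by
    rw [← hk]; exact hs.natDegree_eq_card_roots.symm
  have he : P.eval z = P.leadingCoeff * (P.roots.map fun a => z - a).prod := by
    conv_lhs => rw [hs.eq_prod_roots]
    rw [Polynomial.eval_mul, Polynomial.eval_C, Polynomial.eval_multiset_prod, Multiset.map_map]
    simp
  have hl : P.leadingCoeff = P.coeff k := by rw [← hk]; rfl
  by_cases hP : P = 0
  · subst hP; simp
  rw [he, norm_mul, hl]
  refine mul_le_mul_of_nonneg_left ?_ (norm_nonneg _)
  have gen : ∀ s : Multiset ℂ, (∀ a ∈ s, a.im ≤ 0) →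
      z.im ^ s.card ≤ ‖(s.map fun a => z - a).prod‖ := by
    intro s
    induction s using Multiset.induction_on with
    | empty => simp
    | cons a s ih =>
      intro hs
      have h1 := ih fun b hb => hs b (Multiset.mem_cons_of_mem hb)
      have h2 := hs a (Multiset.mem_cons_self a s)
      rw [Multiset.card_cons, Multiset.map_cons, Multiset.prod_cons, norm_mul, pow_succ, mul_comm]
      refine mul_le_mul ?_ h1 (by positivity) (norm_nonneg _)
      have := Complex.abs_im_le_norm (z - a)
      have h4 := le_abs_self (z - a).im
      simp only [Complex.sub_im] at this h4
      linarith
  have := gen P.roots (fun a ha => by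
    by_contra hc
    exact h a (by linarith) ((Polynomial.mem_roots hP).1 ha))
  rwa [hc] at this

lemma contin (P : ℝ → Polynomial ℂ) (k : ℕ) (a : ℂ) (ha : a ≠ 0)
    (hdeg : ∀ r, (P r).natDegree ≤ k) (hlead : ∀ r, (P r).coeff k = a)
    (hcont : ∀ j, Continuous fun r => (P r).coeff j)
    (hreal : ∀ r ∈ Set.Icc (0:ℝ) 1, ∀ u : ℝ, (P r).eval (u : ℂ) ≠ 0)
    (h0 : ∀ z : ℂ, 0 ≤ z.im → (P 0).eval z ≠ 0) (z : ℂ) (hz : 0 ≤ z.im) :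
    (P 1).eval z ≠ 0 ∧ ‖a‖ * z.im ^ k ≤ ‖(P 1).eval z‖ := by
  have hnd : ∀ r, (P r).natDegree = k := fun r =>
    le_antisymm (hdeg r) (Polynomial.le_natDegree_of_ne_zero (by rw [hlead]; exact ha))
  have hev : ∀ r z, (P r).eval z = ∑ j ∈ Finset.range (k+1), (P r).coeff j * z ^ j := fun r z => by
    rw [Polynomial.eval_eq_sum_range, hnd]
  have hevc : Continuous fun p : ℝ × ℂ => (P p.1).eval p.2 := by
    simp only [hev]
    refine continuous_finsetSum _ fun j _ => ?_
    exact ((hcont j).comp continuous_fst).mul (continuous_snd.pow j)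
  -- uniform root bound
  obtain ⟨L, hL⟩ : ∃ L : ℝ, ∀ r ∈ Set.Icc (0:ℝ) 1, ∀ z : ℂ, (P r).eval z = 0 → ‖z‖ ≤ L := by
    have hbd : ∀ j, ∃ L : ℝ, ∀ r ∈ Set.Icc (0:ℝ) 1, ‖(P r).coeff j‖ ≤ L := fun j =>
      isCompact_Icc.exists_bound_of_continuousOn (hcont j).continuousOn
    choose B hB using hbd
    refine ⟨1 + ∑ j ∈ Finset.range k, |B j| / ‖a‖, fun r hr z hz => ?_⟩
    have hapos : 0 < ‖a‖ := norm_pos_iff.2 ha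
    by_contra hcon
    push Not at hcon
    have hsum : 0 ≤ ∑ j ∈ Finset.range k, |B j| / ‖a‖ :=
      Finset.sum_nonneg fun j _ => by positivity
    have hz1 : 1 ≤ ‖z‖ := by linarith
    rw [hev, Finset.sum_range_succ, hlead] at hz
    have h1 : ‖a * z ^ k‖ = ‖∑ j ∈ Finset.range k, (P r).coeff j * z ^ j‖ := by
      rw [← norm_neg]; congr 1; linear_combination -hz
    rcases Nat.eq_zero_or_pos k with hk | hk
    · subst hk
      simp at h1
      exact ha h1
    have h2 : ‖∑ j ∈ Finset.range k, (P r).coeff j * z ^ j‖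
        ≤ ∑ j ∈ Finset.range k, |B j| * ‖z‖ ^ (k-1) := by
      refine (norm_sum_le _ _).trans (Finset.sum_le_sum fun j hj => ?_)
      rw [norm_mul, norm_pow]
      refine mul_le_mul ((hB j r hr).trans (le_abs_self _)) ?_ (by positivity) (abs_nonneg _)
      exact pow_le_pow_right₀ hz1 (by simp at hj; omega)
    rw [← h1, norm_mul, norm_pow, ← Finset.sum_mul] at h2
    have h3 : ‖z‖ ^ k = ‖z‖ * ‖z‖ ^ (k-1) := by
      rw [← pow_succ']; congr 1; omega
    rw [h3, ← mul_assoc] at h2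
    have h4 : ‖a‖ * ‖z‖ ≤ ∑ j ∈ Finset.range k, |B j| :=
      le_of_mul_le_mul_right h2 (by positivity)
    rw [← Finset.sum_div] at hcon
    have h5 : (∑ j ∈ Finset.range k, |B j|) / ‖a‖ < ‖z‖ := by linarith
    rw [div_lt_iff₀ hapos] at h5
    linarith
  -- the good set
  let E : Set ℝ := {r | ∀ z : ℂ, 0 ≤ z.im → ‖a‖ * z.im ^ k ≤ ‖(P r).eval z‖}
  let K : Set (ℝ × ℂ) := (Set.Icc (0:ℝ) 1 ×ˢ Metric.closedBall (0:ℂ) L) ∩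
    {p | 0 ≤ p.2.im ∧ (P p.1).eval p.2 = 0}
  have hE : IsClosed E := by
    have : E = ⋂ z : ℂ, ⋂ _ : 0 ≤ z.im, {r | ‖a‖ * z.im ^ k ≤ ‖(P r).eval z‖} := by
      ext r; simp [E]
    rw [this]
    refine isClosed_iInter fun z => isClosed_iInter fun _ => ?_
    exact isClosed_le continuous_const
      ((hevc.comp (continuous_id.prodMk continuous_const)).norm)
  have hK : IsCompact K := by
    refine (isCompact_Icc.prod (isCompact_closedBall 0 L)).inter_right ?_
    exact (isClosed_le continuous_const (Complex.continuous_im.comp continuous_snd)).inter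
      (isClosed_eq hevc continuous_const)
  have hK' : IsClosed (Prod.fst '' K) := (hK.image continuous_fst).isClosed
  have hcover : Set.Icc (0:ℝ) 1 ⊆ E ∪ Prod.fst '' K := by
    intro r hr
    by_cases h : ∀ z : ℂ, 0 < z.im → (P r).eval z ≠ 0
    · left
      intro z hz
      rw [← hlead r]
      exact lower_half (P r) k (hnd r) h z hz
    · right
      push Not at h
      obtain ⟨z, hz, hz0⟩ := h
      exact ⟨(r, z), ⟨⟨hr, by simpa using hL r hr z hz0⟩, hz.le, hz0⟩, rfl⟩
  have hdisj : ∀ r ∈ Set.Icc (0:ℝ) 1, r ∈ E → r ∉ Prod.fst '' K := by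
    rintro r hr hrE ⟨⟨r', z⟩, ⟨_, hz, hz0⟩, rfl⟩
    simp only at hz hz0 hr hrE
    rcases hz.eq_or_lt with h | h
    · have : z = (z.re : ℂ) := by
        apply Complex.ext <;> simp [h.symm]
      rw [this] at hz0
      exact hreal r' hr _ hz0
    · have := hrE z hz
      rw [hz0, norm_zero] at this
      have : 0 < ‖a‖ * z.im ^ k := mul_pos (norm_pos_iff.2 ha) (pow_pos h k)
      linarith
  have h0E : (0:ℝ) ∈ E := by
    intro z hz
    rw [← hlead 0]
    exact lower_half (P 0) k (hnd 0) (fun z hz => h0 z hz.le) z hz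
  have h1E : (1:ℝ) ∈ E := by
    by_contra hcon
    have hpre : IsPreconnected (Set.Icc (0:ℝ) 1) := isPreconnected_Icc
    rw [isPreconnected_closed_iff] at hpre
    obtain ⟨r, hr, hrE, hrK⟩ := hpre E _ hE hK' hcover ⟨0, by simp, h0E⟩
      ⟨1, by simp, (hcover (by simp : (1:ℝ) ∈ Set.Icc (0:ℝ) 1)).resolve_left hcon⟩
    exact hdisj r hr hrE hrK
  refine ⟨?_, h1E z hz⟩
  intro hz0
  exact hdisj 1 (by simp) h1E ⟨(1, z), ⟨⟨by simp, by simpa using hL 1 (by simp) z hz0⟩, hz, hz0⟩, rfl⟩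

/-- complexification of a real matrix -/
noncomputable abbrev cm {m : ℕ} (A : Matrix (Fin m) (Fin m) ℝ) : Matrix (Fin m) (Fin m) ℂ :=
  A.map Complex.ofRealHom

open ComplexOrder in
lemma det_ne {m : ℕ} (Y : Matrix (Fin m) (Fin m) ℝ) (hY : Y.IsSymm) (t : ℂ) (ht : 0 < t.im) :
    (t • (1 : Matrix (Fin m) (Fin m) ℂ) + cm Y).det ≠ 0 := by
  intro h
  obtain ⟨v, hv, hv0⟩ := Matrix.exists_mulVec_eq_zero_iff.2 h
  have hH : (cm Y).IsHermitian := by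
    ext i j
    simp only [Matrix.conjTranspose_apply, Matrix.map_apply, Complex.ofRealHom_eq_coe, 
      Complex.star_def, Complex.conj_ofReal]
    rw [hY.apply]
  have h1 : star v ⬝ᵥ ((t • (1 : Matrix (Fin m) (Fin m) ℂ) + cm Y) *ᵥ v) = 0 := by
    rw [hv0]; simp
  rw [Matrix.add_mulVec, dotProduct_add, Matrix.smul_mulVec, Matrix.one_mulVec,
    dotProduct_smul] at h1
  have h2 : (star v ⬝ᵥ (cm Y *ᵥ v)).im = 0 := hH.im_star_dotProduct_mulVec_self v
  have h3 : 0 < star v ⬝ᵥ v := by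
    exact dotProduct_star_self_pos_iff.2 hv
  obtain ⟨h4, h5⟩ := Complex.lt_def.1 h3
  have h6 := congrArg Complex.im h1
  simp only [Complex.add_im, smul_eq_mul, Complex.mul_im, h2] at h6
  simp only [Complex.zero_re, Complex.zero_im] at h4 h5
  rw [← h5] at h6
  have := mul_pos ht h4
  simp at h6
  rcases h6 with h6 | h6 <;> linarith

lemma sig_I {m k : ℕ} (hk : k ≤ m) (Y : Matrix (Fin m) (Fin m) ℝ) (hY : Y.IsSymm) (t : ℂ)
    (ht : 0 < t.im) : sigmaM k (t • (1 : Matrix (Fin m) (Fin m) ℂ) + cm Y) ≠ 0 := by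
  set Z := t • (1 : Matrix (Fin m) (Fin m) ℂ) + cm Y with hZ
  let P : Polynomial ℂ := ∑ j ∈ Finset.range (m+1), Polynomial.C (sigmaM j Z) * Polynomial.X ^ (m - j)
  have hP : ∀ z, P.eval z = (z • (1 : Matrix (Fin m) (Fin m) ℂ) + Z).det := by
    intro z
    have := det_lin' Z z 1
    rw [one_smul] at this
    rw [this]
    simp only [P, Polynomial.eval_finsetSum, Polynomial.eval_mul, Polynomial.eval_C,
      Polynomial.eval_pow, Polynomial.eval_X]
    refine Finset.sum_congr rfl fun j _ => ?_
    ring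
  have hcoef : ∀ j ≤ m, P.coeff (m - j) = sigmaM j Z := by
    intro j hj
    simp only [P, Polynomial.finsetSum_coeff, Polynomial.coeff_C_mul_X_pow]
    rw [Finset.sum_eq_single j]
    · simp
    · intro b hb hne
      rw [if_neg]
      simp at hb; omega
    · intro h; simp at h; omega
  have hiter : ∀ n ≤ m, ∀ z : ℂ, 0 ≤ z.im → (Polynomial.derivative^[n] P).eval z ≠ 0 := by
    intro n
    induction n with
    | zero =>
      intro _ z hz
      simp only [Function.iterate_zero, id]
      rw [hP, hZ, ← add_assoc, ← add_smul]
      exact det_ne Y hY _ (by simp; linarith)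
    | succ n ih =>
      intro hn z hz
      rw [Function.iterate_succ_apply']
      refine gl_half _ ?_ (ih (by omega)) z hz
      have hc : (Polynomial.derivative^[n] P).coeff (m - n) ≠ 0 := by
        rw [Polynomial.coeff_iterate_derivative]
        have h1 : m - n + n = m - 0 := by omega
        rw [h1, hcoef 0 (by omega), sigmaM_zero]
        simp [Nat.descFactorial_eq_zero_iff_lt]
        omega
      have := Polynomial.le_degree_of_ne_zero hc
      refine lt_of_lt_of_le ?_ this
      exact_mod_cast (by omega : 0 < m - n)
  have h1 := hiter (m - k) (by omega) 0 (by simp)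
  rw [← Polynomial.coeff_zero_eq_eval_zero, Polynomial.coeff_iterate_derivative, zero_add,
    hcoef k hk] at h1
  intro h
  rw [h] at h1
  simp at h1

/-! ### one-variable polynomials from multilinear maps -/

/-- restriction of a multilinear map to a line in the slots `S` -/
noncomputable def mlPoly {k : ℕ} {V : Type*} [AddCommGroup V] [Module ℂ V]
    (f : MultilinearMap ℂ (fun _ : Fin k => V) ℂ) (S : Finset (Fin k)) (A : Fin k → V) (B : V) :
    Polynomial ℂ :=
  ∑ T ∈ S.powerset, Polynomial.C (f (T.piecewise (fun _ => B) A)) * Polynomial.X ^ T.card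

section ml
variable {k : ℕ} {V : Type*} [AddCommGroup V] [Module ℂ V]
    (f : MultilinearMap ℂ (fun _ : Fin k => V) ℂ) (S : Finset (Fin k)) (A : Fin k → V) (B : V)

lemma mlPoly_eval (s : ℂ) :
    (mlPoly f S A B).eval s = f (S.piecewise (fun i => A i + s • B) A) := by
  have h := f.map_piecewise_add (fun _ => s • B) A S
  have e : S.piecewise ((fun _ => s • B) + A) A = S.piecewise (fun i => A i + s • B) A := by
    congr 1; funext i; simp [add_comm]
  rw [e] at h
  rw [h, mlPoly, Polynomial.eval_finsetSum]
  refine Finset.sum_congr rfl fun T _ => ?_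
  have h2 := f.map_piecewise_smul (fun _ => s) (T.piecewise (fun _ => B) A) T
  have e2 : T.piecewise (fun i => s • (T.piecewise (fun _ => B) A) i) (T.piecewise (fun _ => B) A)
      = T.piecewise (fun _ => s • B) A := by
    funext i; by_cases hi : i ∈ T <;> simp [hi]
  rw [e2] at h2
  rw [h2]
  simp only [Polynomial.eval_mul, Polynomial.eval_C, Polynomial.eval_pow, Polynomial.eval_X,
    Finset.prod_const, smul_eq_mul]
  ring

lemma mlPoly_natDegree : (mlPoly f S A B).natDegree ≤ S.card := by
  refine Polynomial.natDegree_sum_le_of_forall_le _ _ fun T hT => ?_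
  refine (Polynomial.natDegree_C_mul_X_pow_le _ _).trans ?_
  exact Finset.card_le_card (Finset.mem_powerset.1 hT)

lemma mlPoly_lead : (mlPoly f S A B).coeff S.card = f (S.piecewise (fun _ => B) A) := by
  simp only [mlPoly, Polynomial.finsetSum_coeff, Polynomial.coeff_C_mul_X_pow]
  rw [Finset.sum_eq_single S]
  · simp
  · intro T hT hne
    rw [if_neg]
    intro hc
    exact hne (Finset.eq_of_subset_of_card_le (Finset.mem_powerset.1 hT) hc.le)
  · simp

lemma mlPoly_coeff_one : (mlPoly f S A B).coeff 1 = ∑ i ∈ S, f (Function.update A i B) := by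
  simp only [mlPoly, Polynomial.finsetSum_coeff, Polynomial.coeff_C_mul_X_pow]
  rw [← Finset.sum_filter]
  have : S.powerset.filter (fun T => 1 = T.card) = S.image (fun i => {i}) := by
    ext T
    simp only [Finset.mem_filter, Finset.mem_powerset, Finset.mem_image]
    constructor
    · rintro ⟨h1, h2⟩
      obtain ⟨i, rfl⟩ := Finset.card_eq_one.1 h2.symm
      exact ⟨i, by simpa using h1, rfl⟩
    · rintro ⟨i, hi, rfl⟩
      simpa using hi
  rw [this, Finset.sum_image (by intro a _ b _ h; simpa using h)]
  refine Finset.sum_congr rfl fun i _ => ?_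
  rw [Finset.piecewise_singleton]

end ml

lemma MM_continuous {m k : ℕ} {X : Type*} [TopologicalSpace X]
    (Z : X → Fin k → Matrix (Fin m) (Fin m) ℂ) (h : ∀ a, Continuous fun x => Z x a) :
    Continuous fun x => MM m k ℂ (Z x) := by
  simp only [MM_apply]
  unfold MR
  refine continuous_finsetSum _ fun c _ => ?_
  refine Continuous.matrix_det ?_
  refine continuous_matrix fun i j => ?_
  simp only [rowC, Matrix.of_apply]
  cases hc : c i with
  | none => simpa using continuous_const
  | some a => simpa using (h a).matrix_elem i j
/-! ### Gårding's stability argument -/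

lemma sig_pos {m k : ℕ} (hk : k ≤ m) (W : Matrix (Fin m) (Fin m) ℝ) (hW : matGamma k W) (t : ℝ)
    (ht : 0 ≤ t) : 0 < sigmaM k (t • (1 : Matrix (Fin m) (Fin m) ℝ) + W) := by
  have h := sigmaM_add W t 1 k hk
  rw [one_smul] at h
  have hpos : ∀ j ≤ k, 0 < sigmaM j W := by
    intro j hj
    rcases Nat.eq_zero_or_pos j with h0 | h0
    · subst h0; rw [sigmaM_zero]; exact one_pos
    · exact hW j h0 hj
  rw [h]
  refine Finset.sum_pos' (fun j hj => ?_) ⟨k, by simp, ?_⟩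
  · have := hpos j (by simp at hj; omega)
    positivity
  · have := hpos k le_rfl
    simpa using this

lemma base_ne {m k : ℕ} (hk : k ≤ m) (W : Matrix (Fin m) (Fin m) ℝ) (hs : W.IsSymm)
    (hW : matGamma k W) (δ : ℝ) (hδ : 0 < δ) (u : ℂ) (hu : 0 ≤ u.im) :
    sigmaM k ((Complex.I * δ) • (1 : Matrix (Fin m) (Fin m) ℂ) + u • cm W) ≠ 0 := by
  by_cases hu0 : u = 0
  · have := sig_I hk (0 : Matrix (Fin m) (Fin m) ℝ) (by simp [Matrix.IsSymm]) (Complex.I * δ)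
      (by simpa using hδ)
    subst hu0
    simpa [cm] using this
  · set τ : ℂ := Complex.I * δ / u with hτ
    have e : (Complex.I * δ) • (1 : Matrix (Fin m) (Fin m) ℂ) + u • cm W =
        u • (τ • (1 : Matrix (Fin m) (Fin m) ℂ) + cm W) := by
      rw [smul_add, smul_smul, hτ, mul_div_cancel₀ _ hu0]
    rw [e, sigmaM_smul _ _ _ hk]
    refine mul_ne_zero (pow_ne_zero _ hu0) ?_
    rcases lt_trichotomy τ.im 0 with h | h | h
    · have h1 := sig_I hk (-W) (by rw [Matrix.IsSymm, Matrix.transpose_neg, hs]) (-τ) (by simpa using h)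
      have e2 : (-τ) • (1 : Matrix (Fin m) (Fin m) ℂ) + cm (-W) =
        (-1 : ℂ) • (τ • (1 : Matrix (Fin m) (Fin m) ℂ) + cm W) := by
        ext i j; simp; ring
      rw [e2, sigmaM_smul _ _ _ hk] at h1
      exact right_ne_zero_of_mul h1
    · have hre : 0 ≤ τ.re := by
        rw [hτ, Complex.div_re]
        simp only [Complex.mul_re, Complex.I_re, Complex.I_im, Complex.ofReal_re,
          Complex.ofReal_im, Complex.mul_im, zero_mul, one_mul, mul_zero, zero_div, sub_self,
          zero_add]
        exact div_nonneg (mul_nonneg hδ.le hu) (Complex.normSq_nonneg u)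
      have e2 : τ • (1 : Matrix (Fin m) (Fin m) ℂ) + cm W =
        cm (τ.re • (1 : Matrix (Fin m) (Fin m) ℝ) + W) := by
        have : τ = (τ.re : ℂ) := by apply Complex.ext <;> simp [h]
        ext i j
        rw [this]
        by_cases hij : i = j <;> simp [hij]
      rw [e2, sigmaM_map]
      have := sig_pos hk W hW _ hre
      simpa using this.ne'
    · exact sig_I hk W hs τ h

/-- `k! σ_k` on complex matrices -/
noncomputable def FC {m : ℕ} (k : ℕ) (Z : Matrix (Fin m) (Fin m) ℂ) : ℂ := MM m k ℂ (fun _ => Z)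

lemma FC_eq {m k : ℕ} (hk : k ≤ m) (Z : Matrix (Fin m) (Fin m) ℂ) :
    FC k Z = k.factorial * sigmaM k Z := MM_diag hk Z

lemma FC_ne_iff {m k : ℕ} (hk : k ≤ m) (Z : Matrix (Fin m) (Fin m) ℂ) :
    FC k Z ≠ 0 ↔ sigmaM k Z ≠ 0 := by
  rw [FC_eq hk]
  simp [Nat.factorial_ne_zero]

lemma FC_W_ne {m k : ℕ} (hk : k ≤ m) (W : Matrix (Fin m) (Fin m) ℝ) (hW : matGamma k W) :
    FC k (cm W) ≠ 0 := by
  rw [FC_ne_iff hk, sigmaM_map]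
  have := sig_pos hk W hW 0 le_rfl
  simp at this ⊢
  exact this.ne'

lemma core {m k : ℕ} (hk : k ≤ m) (Z : Matrix (Fin m) (Fin m) ℂ)
    (W : Matrix (Fin m) (Fin m) ℝ) (hs : W.IsSymm)
    (hW : matGamma k W) (δ : ℝ) (hδ : 0 < δ)
    (h : ∀ q ∈ Set.Icc (0:ℝ) 1, ∀ u : ℝ,
      FC k ((q : ℂ) • Z + (Complex.I * δ) • (1 : Matrix (Fin m) (Fin m) ℂ) + (u : ℂ) • cm W) ≠ 0)
    (u : ℂ) (hu : 0 ≤ u.im) :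
    FC k (Z + (Complex.I * δ) • (1 : Matrix (Fin m) (Fin m) ℂ) + u • cm W) ≠ 0 ∧
    ‖FC k (cm W)‖ * u.im ^ k ≤
      ‖FC k (Z + (Complex.I * δ) • (1 : Matrix (Fin m) (Fin m) ℂ) + u • cm W)‖ := by
  let P : ℝ → Polynomial ℂ := fun q => mlPoly (MM m k ℂ) Finset.univ
    (fun _ => (q : ℂ) • Z + (Complex.I * δ) • (1 : Matrix (Fin m) (Fin m) ℂ)) (cm W)
  have hP : ∀ q u, (P q).eval u =
      FC k ((q : ℂ) • Z + (Complex.I * δ) • (1 : Matrix (Fin m) (Fin m) ℂ) + u • cm W) := by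
    intro q u
    simp only [P, mlPoly_eval, Finset.piecewise_univ, FC]
  have key := contin P k (FC k (cm W)) (FC_W_ne hk W hW) (fun r => by
      have := mlPoly_natDegree (MM m k ℂ) Finset.univ
        (fun _ => (r : ℂ) • Z + (Complex.I * δ) • (1 : Matrix (Fin m) (Fin m) ℂ)) (cm W)
      rw [Finset.card_univ, Fintype.card_fin] at this
      exact this) (fun r => by
      have := mlPoly_lead (MM m k ℂ) Finset.univ
        (fun _ => (r : ℂ) • Z + (Complex.I * δ) • (1 : Matrix (Fin m) (Fin m) ℂ)) (cm W)
      simp only [Finset.card_univ, Fintype.card_fin, Finset.piecewise_univ] at this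
      exact this) (fun j => by
      simp only [P, mlPoly, Polynomial.finsetSum_coeff, Polynomial.coeff_C_mul_X_pow]
      refine continuous_finsetSum _ fun T _ => ?_
      split_ifs
      · refine MM_continuous _ fun a => ?_
        by_cases ha : a ∈ T
        · simpa [ha] using continuous_const
        · simp only [ha, not_false_eq_true, Finset.piecewise_eq_of_notMem]
          fun_prop
      · exact continuous_const)
    (fun q hq u => by rw [hP]; exact h q hq u)
    (fun z hz => by
      rw [hP, FC_ne_iff hk]
      have := base_ne hk W hs hW δ hδ z hz
      simpa using this) u hu
  rw [hP] at key
  simpa using key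

/-- the tube over the cone -/
inductive HH {m : ℕ} (k : ℕ) : Matrix (Fin m) (Fin m) ℂ → Prop
  | real (Y : Matrix (Fin m) (Fin m) ℝ) (hY : Y.IsSymm) : HH k (cm Y)
  | add (Z : Matrix (Fin m) (Fin m) ℂ) (s : ℂ) (W : Matrix (Fin m) (Fin m) ℝ) (hZ : HH k Z)
      (hs : 0 ≤ s.im) (hW : W.IsSymm) (hg : matGamma k W) : HH k (Z + s • cm W)

lemma HH_ne {m k : ℕ} (hk : k ≤ m) (Z : Matrix (Fin m) (Fin m) ℂ) (hZ : HH k Z) :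
    ∀ (r : ℝ) (_ : 0 ≤ r) (Y : Matrix (Fin m) (Fin m) ℝ) (_ : Y.IsSymm) (δ : ℝ) (_ : 0 < δ),
      FC k ((r : ℂ) • Z + cm Y + (Complex.I * δ) • (1 : Matrix (Fin m) (Fin m) ℂ)) ≠ 0 := by
  induction hZ with
  | real Y0 hY0 =>
    intro r hr Y hY δ hδ
    rw [FC_ne_iff hk]
    have := sig_I hk (r • Y0 + Y) (by
      rw [Matrix.IsSymm, Matrix.transpose_add, Matrix.transpose_smul, hY0, hY])
      (Complex.I * δ) (by simpa using hδ)
    convert this using 2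
    rw [add_comm]
    congr 1
    ext i j; simp
  | add Z s W hZ hs hW hg ih =>
    intro r hr Y hY δ hδ
    have := (core hk ((r : ℂ) • Z + cm Y) W hW hg δ hδ (fun q hq u => by
      have := ih (q * r) (mul_nonneg hq.1 hr) (q • Y + u • W) (by
        rw [Matrix.IsSymm, Matrix.transpose_add, Matrix.transpose_smul, Matrix.transpose_smul,
          hW, hY]) δ hδ
      convert this using 2
      ext i j; simp; ring) (r * s) (by simp; positivity)).1
    convert this using 2
    ext i j; simp; ring

lemma HH_bound {m k : ℕ} (hk : k ≤ m) (Z : Matrix (Fin m) (Fin m) ℂ) (hZ : HH k Z)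
    (W : Matrix (Fin m) (Fin m) ℝ) (hW : W.IsSymm) (hg : matGamma k W) (u : ℂ) (hu : 0 < u.im) :
    FC k (Z + u • cm W) ≠ 0 := by
  have h1 : ∀ δ : ℝ, 0 < δ → ‖FC k (cm W)‖ * u.im ^ k ≤
      ‖FC k (Z + (Complex.I * δ) • (1 : Matrix (Fin m) (Fin m) ℂ) + u • cm W)‖ := by
    intro δ hδ
    refine (core hk Z W hW hg δ hδ (fun q hq v => ?_) u hu.le).2
    have := HH_ne hk Z hZ q hq.1 (v • W) (by rw [Matrix.IsSymm, Matrix.transpose_smul, hW]) δ hδ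
    convert this using 2
    ext i j; simp; ring
  have hc : Continuous fun δ : ℝ =>
      ‖FC k (Z + (Complex.I * δ) • (1 : Matrix (Fin m) (Fin m) ℂ) + u • cm W)‖ := by
    refine Continuous.norm ?_
    refine MM_continuous _ fun a => ?_
    fun_prop
  have h2 : ‖FC k (cm W)‖ * u.im ^ k ≤
      ‖FC k (Z + (Complex.I * (0:ℝ)) • (1 : Matrix (Fin m) (Fin m) ℂ) + u • cm W)‖ := by
    refine ge_of_tendsto (hc.continuousWithinAt (s := Set.Ioi 0)).tendsto ?_
    filter_upwards [self_mem_nhdsWithin] with δ hδ using h1 δ hδ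
  intro h0
  simp only [Complex.ofReal_zero, mul_zero, zero_smul, add_zero, h0, norm_zero] at h2
  have : 0 < ‖FC k (cm W)‖ * u.im ^ k :=
    mul_pos (norm_pos_iff.2 (FC_W_ne hk W hg)) (pow_pos hu k)
  linarith

/-- mixed stability -/
lemma mixed_ne {m k : ℕ} (hk : k ≤ m) (V : Fin k → Matrix (Fin m) (Fin m) ℝ)
    (hV : ∀ i, (V i).IsSymm) (hg : ∀ i, matGamma k (V i)) (T : Finset (Fin k)) :
    ∀ (Z : Matrix (Fin m) (Fin m) ℂ) (_ : HH k Z) (A : Matrix (Fin m) (Fin m) ℝ) (_ : A.IsSymm)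
      (_ : matGamma k A) (u : ℂ) (_ : 0 < u.im),
      MM m k ℂ (T.piecewise (fun i => cm (V i)) (fun _ => Z + u • cm A)) ≠ 0 := by
  induction T using Finset.induction_on with
  | empty =>
    intro Z hZ A hA hgA u hu
    rw [Finset.piecewise_empty]
    exact HH_bound hk Z hZ A hA hgA u hu
  | insert i0 T hi0 ih =>
    intro Z hZ A hA hgA u hu
    set m' : Fin k → Matrix (Fin m) (Fin m) ℂ :=
      T.piecewise (fun i => cm (V i)) (fun _ => Z + u • cm A) with hm'
    let P := mlPoly (MM m k ℂ) Tᶜ m' (cm (V i0))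
    have hiT : i0 ∈ Tᶜ := by simpa using hi0
    have hP : ∀ z : ℂ, 0 ≤ z.im → P.eval z ≠ 0 := by
      intro z hz
      simp only [P, mlPoly_eval]
      have := ih (Z + z • cm (V i0)) (HH.add Z z _ hZ hz (hV i0) (hg i0)) A hA hgA u hu
      convert this using 2
      funext i
      by_cases hi : i ∈ T
      · simp [hi, hm']
      · simp [hi, hm']; abel
    have hlead : P.coeff (Tᶜ).card ≠ 0 := by
      simp only [P, mlPoly_lead]
      have h1 := ih (cm 0) (HH.real 0 (by simp [Matrix.IsSymm])) (V i0) (hV i0) (hg i0)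
        Complex.I (by simp)
      have e : T.piecewise (fun i => cm (V i)) (fun _ => cm 0 + Complex.I • cm (V i0)) =
          (Tᶜ).piecewise (fun i => Complex.I • (Tᶜ).piecewise (fun _ => cm (V i0)) m' i)
            ((Tᶜ).piecewise (fun _ => cm (V i0)) m') := by
        funext i
        by_cases hi : i ∈ T <;> simp [hi, hm', cm]
      rw [e, MultilinearMap.map_piecewise_smul] at h1
      exact right_ne_zero_of_mul h1
    have hdeg : 0 < P.degree := by
      refine lt_of_lt_of_le ?_ (Polynomial.le_degree_of_ne_zero hlead)
      have : 0 < (Tᶜ).card := Finset.card_pos.2 ⟨i0, hiT⟩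
      exact_mod_cast this
    have hd := gl_half P hdeg hP 0 (by simp)
    rw [← Polynomial.coeff_zero_eq_eval_zero, Polynomial.coeff_derivative] at hd
    simp only [zero_add, P, mlPoly_coeff_one] at hd
    have hall : ∀ i ∈ Tᶜ, MM m k ℂ (Function.update m' i (cm (V i0))) =
        MM m k ℂ (Function.update m' i0 (cm (V i0))) := by
      intro i hi
      rw [MM_apply, MM_apply, ← MR_perm _ (Equiv.swap i i0)]
      congr 1
      funext a
      have hiT' : i ∉ T := by simpa using hi
      rcases eq_or_ne i i0 with rfl | hne
      · rw [Equiv.swap_self]; rfl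
      by_cases h1 : a = i
      · subst h1
        rw [Equiv.swap_apply_left, Function.update_of_ne hne.symm, Function.update_of_ne hne]
        simp [hm', hiT', hi0]
      by_cases h2 : a = i0
      · subst h2
        rw [Equiv.swap_apply_right, Function.update_self, Function.update_self]
      rw [Equiv.swap_apply_of_ne_of_ne h1 h2, Function.update_of_ne h1, Function.update_of_ne h2]
    rw [Finset.sum_congr rfl hall, Finset.sum_const] at hd
    intro h0
    apply hd
    have e : (insert i0 T).piecewise (fun i => cm (V i)) (fun _ => Z + u • cm A) =
        Function.update m' i0 (cm (V i0)) := by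
      rw [Finset.piecewise_insert]
    rw [← e, h0]
    simp
/-! ### Quadratic and cubic forms -/

lemma quad_real (a b c : ℝ) (ha : a ≠ 0)
    (h : ∀ u : ℂ, 0 < u.im → (a : ℂ) * u ^ 2 + 2 * b * u + c ≠ 0) : a * c ≤ b ^ 2 := by
  by_contra hcon
  push Not at hcon
  have hD : 0 < a * c - b ^ 2 := by linarith
  set r := Real.sqrt (a * c - b ^ 2) with hr
  have hr2 : r ^ 2 = a * c - b ^ 2 := Real.sq_sqrt hD.le
  have hrp : 0 < r := Real.sqrt_pos.2 hD
  have hap : 0 < |a| := abs_pos.2 ha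
  refine h (((-b / a : ℝ) : ℂ) + ((r / |a| : ℝ) : ℂ) * Complex.I) ?_ ?_
  · simp; positivity
  · have ha' : (a : ℂ) ≠ 0 := by exact_mod_cast ha
    have h1 : ((r / |a| : ℝ) : ℂ) ^ 2 = (a * c - b ^ 2) / (a : ℂ) ^ 2 := by
      have : (r / |a|) ^ 2 = (a * c - b ^ 2) / a ^ 2 := by
        rw [div_pow, hr2, sq_abs]
      exact_mod_cast congrArg (fun x : ℝ => (x : ℂ)) this
    have h2 : (a : ℂ) * (((-b / a : ℝ) : ℂ) + ((r / |a| : ℝ) : ℂ) * Complex.I) ^ 2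
        = a * ((-b / a : ℝ) : ℂ) ^ 2 + 2 * a * ((-b / a : ℝ) : ℂ) * (((r / |a| : ℝ) : ℂ) * Complex.I)
          - a * ((r / |a| : ℝ) : ℂ) ^ 2 := by
      linear_combination (a * ((r / |a| : ℝ) : ℂ) ^ 2) * Complex.I_sq
    rw [h2, h1]
    push_cast
    field_simp
    ring

lemma cubic_real (a b c d : ℝ) (ha : a ≠ 0)
    (h : ∀ u : ℂ, 0 < u.im → (a : ℂ) * u ^ 3 + 3 * b * u ^ 2 + 3 * c * u + d ≠ 0) :
    (d / a) ^ 2 ≤ (9 * (b / a) ^ 2 - 6 * (c / a)) ^ 3 := by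
  have ha' : (a : ℂ) ≠ 0 := by exact_mod_cast ha
  have hne : ∀ u : ℂ, (a : ℂ) * u ^ 3 + 3 * b * u ^ 2 + 3 * c * u + d = 0 → u.im = 0 := by
    intro u hu
    rcases lt_trichotomy u.im 0 with h1 | h1 | h1
    · exfalso
      refine h (starRingEnd ℂ u) (by simpa using h1) ?_
      have := congrArg (starRingEnd ℂ) hu
      have h3 : (starRingEnd ℂ) 3 = 3 := map_ofNat _ 3
      simpa [h3] using this
    · exact h1
    · exact absurd hu (h u h1)
  obtain ⟨z, hz⟩ : ∃ z : ℂ, (a : ℂ) * z ^ 3 + 3 * b * z ^ 2 + 3 * c * z + d = 0 := by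
    let P : Polynomial ℂ := Polynomial.C (a : ℂ) * Polynomial.X ^ 3 +
      Polynomial.C (3 * b : ℂ) * Polynomial.X ^ 2 + Polynomial.C (3 * c : ℂ) * Polynomial.X +
      Polynomial.C (d : ℂ)
    have hP : P.degree = 3 := Polynomial.degree_cubic ha'
    obtain ⟨z, hz⟩ := IsAlgClosed.exists_root P (by rw [hP]; decide)
    refine ⟨z, ?_⟩
    simpa [P, Polynomial.IsRoot] using hz
  have hz0 := hne z hz
  set x := z.re with hx
  have hzx : z = (x : ℂ) := by apply Complex.ext <;> simp [hz0, hx]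
  rw [hzx] at hz
  have hxr : a * x ^ 3 + 3 * b * x ^ 2 + 3 * c * x + d = 0 := by exact_mod_cast hz
  have hq := quad_real a ((a * x + 3 * b) / 2) (a * x ^ 2 + 3 * b * x + 3 * c) ha (by
    intro u hu h0
    apply h u hu
    push_cast at h0
    linear_combination (u - x) * h0 + hz)
  have hd : d = - (x * (a * x ^ 2 + 3 * b * x + 3 * c)) := by linarith
  set β := b / a with hβ
  set γ := c / a with hγ
  set e := x + 3 * β with he
  set f := x ^ 2 + 3 * β * x + 3 * γ with hf
  have hda : d / a = - (x * f) := by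
    rw [hd, hf, hβ, hγ]; field_simp
  have hef : 4 * f ≤ e ^ 2 := by
    have h1 : a * (a * x ^ 2 + 3 * b * x + 3 * c) = a ^ 2 * f := by
      rw [hf, hβ, hγ]; field_simp
    have h2 : ((a * x + 3 * b) / 2) ^ 2 = a ^ 2 * (e ^ 2 / 4) := by
      rw [he, hβ]; field_simp; ring
    rw [h1, h2] at hq
    have : 0 < a ^ 2 := by positivity
    have := le_of_mul_le_mul_left hq this
    linarith
  -- roots of the quadratic
  set r := Real.sqrt (e ^ 2 - 4 * f) with hr
  have hr2 : r ^ 2 = e ^ 2 - 4 * f := Real.sq_sqrt (by linarith)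
  set y := (-e + r) / 2 with hy
  set w := (-e - r) / 2 with hw
  have hyw : y * w = f := by rw [hy, hw]; linear_combination (-1/4) * hr2
  have hyw2 : y + w = - e := by rw [hy, hw]; ring
  have hS : 9 * β ^ 2 - 6 * γ = x ^ 2 + y ^ 2 + w ^ 2 := by
    have e1 : y ^ 2 + w ^ 2 = e ^ 2 - 2 * f := by
      rw [← hyw]; linear_combination (y + w - e) * hyw2
    rw [add_assoc, e1, he, hf]; ring
  rw [hda, hS, ← hyw]
  have hX := sq_nonneg x
  have hY := sq_nonneg y
  have hZ := sq_nonneg w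
  have : (-(x * (y * w))) ^ 2 = x ^ 2 * y ^ 2 * w ^ 2 := by ring
  rw [this]
  generalize x ^ 2 = p at *
  generalize y ^ 2 = q at *
  generalize w ^ 2 = t at *
  calc p * q * t ≤ (p + q + t) * (p + q + t) * (p + q + t) := by
        gcongr <;> linarith
    _ = (p + q + t) ^ 3 := by ring

lemma bdd_quad (a γ β δ d C : ℝ) (ha : a ≠ 0)
    (h : ∀ v : ℝ, ((d * v ^ 3 + 3 * γ * v ^ 2 + 3 * β * v + δ) / a) ^ 2 ≤ C) : γ = 0 := by
  by_contra hγ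
  have hgp : 0 < |γ| := abs_pos.2 hγ
  have hC : 0 ≤ C := (sq_nonneg _).trans (h 0)
  set L := Real.sqrt C * |a| with hL
  have hL0 : 0 ≤ L := by positivity
  have hb : ∀ v : ℝ, |d * v ^ 3 + 3 * γ * v ^ 2 + 3 * β * v + δ| ≤ L := by
    intro v
    have := Real.abs_le_sqrt (h v)
    rw [abs_div, div_le_iff₀ (abs_pos.2 ha)] at this
    exact this
  set w := (L + |δ| + 1) / |γ| with hw
  have hw0 : 0 ≤ w := by positivity
  have h1 := hb (Real.sqrt w)
  have h2 := hb (- Real.sqrt w)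
  have hsq : Real.sqrt w ^ 2 = w := Real.sq_sqrt hw0
  have h3 : |6 * γ * w + 2 * δ| ≤ L + L := by
    have e : 6 * γ * w + 2 * δ =
      (d * (Real.sqrt w) ^ 3 + 3 * γ * (Real.sqrt w) ^ 2 + 3 * β * (Real.sqrt w) + δ) +
      (d * (-Real.sqrt w) ^ 3 + 3 * γ * (-Real.sqrt w) ^ 2 + 3 * β * (-Real.sqrt w) + δ) := by
      linear_combination (-6 * γ) * hsq
    rw [e]
    exact (abs_add_le _ _).trans (add_le_add h1 h2)
  have h4 : |6 * γ * w| ≤ L + L + 2 * |δ| := by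
    have e : 6 * γ * w = (6 * γ * w + 2 * δ) - 2 * δ := by ring
    rw [e]
    refine (abs_sub _ _).trans ?_
    rw [abs_mul 2 δ, abs_two]
    linarith
  have h5 : |6 * γ * w| = 6 * (L + |δ| + 1) := by
    rw [abs_mul, abs_mul, abs_of_nonneg hw0, hw]
    rw [abs_of_pos (by norm_num : (0:ℝ) < 6)]
    field_simp
  have := abs_nonneg δ
  linarith

section forms
variable {m k : ℕ} {R : Type*} [CommRing R]

/-- two free slots -/
noncomputable def B2 (V : Fin k → Matrix (Fin m) (Fin m) R) (i j : Fin k)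
    (X Y : Matrix (Fin m) (Fin m) R) : R :=
  MM m k R (Function.update (Function.update V i X) j Y)

/-- three free slots -/
noncomputable def B3 (V : Fin k → Matrix (Fin m) (Fin m) R) (i j l : Fin k)
    (X Y Z : Matrix (Fin m) (Fin m) R) : R :=
  B2 (Function.update V l Z) i j X Y

lemma MM_swap (i j : Fin k) (Z Z' : Fin k → Matrix (Fin m) (Fin m) R)
    (h1 : Z i = Z' j) (h2 : Z j = Z' i) (h3 : ∀ a, a ≠ i → a ≠ j → Z a = Z' a) :
    MM m k R Z = MM m k R Z' := by
  rw [MM_apply, MM_apply, ← MR_perm Z' (Equiv.swap i j)]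
  congr 1
  funext a
  by_cases ha : a = i
  · subst ha; rw [Equiv.swap_apply_left, h1]
  by_cases hb : a = j
  · subst hb; rw [Equiv.swap_apply_right, h2]
  rw [Equiv.swap_apply_of_ne_of_ne ha hb, h3 a ha hb]

lemma B2_symm (V : Fin k → Matrix (Fin m) (Fin m) R) (i j : Fin k) (hij : i ≠ j)
    (X Y : Matrix (Fin m) (Fin m) R) : B2 V i j X Y = B2 V i j Y X := by
  refine MM_swap i j _ _ ?_ ?_ ?_
  · rw [Function.update_of_ne hij, Function.update_self, Function.update_self]
  · rw [Function.update_of_ne hij, Function.update_self, Function.update_self]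
  · intro a h1 h2
    rw [Function.update_of_ne h2, Function.update_of_ne h1, Function.update_of_ne h2,
      Function.update_of_ne h1]

lemma B2_add_right (V : Fin k → Matrix (Fin m) (Fin m) R) (i j : Fin k)
    (X Y Y' : Matrix (Fin m) (Fin m) R) : B2 V i j X (Y + Y') = B2 V i j X Y + B2 V i j X Y' :=
  (MM m k R).map_update_add _ _ _ _

lemma B2_smul_right (V : Fin k → Matrix (Fin m) (Fin m) R) (i j : Fin k)
    (X Y : Matrix (Fin m) (Fin m) R) (s : R) : B2 V i j X (s • Y) = s * B2 V i j X Y :=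
  (MM m k R).map_update_smul _ _ _ _

lemma B2_add_left (V : Fin k → Matrix (Fin m) (Fin m) R) (i j : Fin k) (hij : i ≠ j)
    (X X' Y : Matrix (Fin m) (Fin m) R) : B2 V i j (X + X') Y = B2 V i j X Y + B2 V i j X' Y := by
  rw [B2_symm V i j hij, B2_add_right, B2_symm V i j hij Y, B2_symm V i j hij Y]

lemma B2_smul_left (V : Fin k → Matrix (Fin m) (Fin m) R) (i j : Fin k) (hij : i ≠ j)
    (X Y : Matrix (Fin m) (Fin m) R) (s : R) : B2 V i j (s • X) Y = s * B2 V i j X Y := by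
  rw [B2_symm V i j hij, B2_smul_right, B2_symm V i j hij Y]

lemma B3_symm (V : Fin k → Matrix (Fin m) (Fin m) R) (i j l : Fin k) (hij : i ≠ j)
    (X Y Z : Matrix (Fin m) (Fin m) R) : B3 V i j l X Y Z = B3 V i j l Y X Z :=
  B2_symm _ i j hij X Y

lemma B3_symm' (V : Fin k → Matrix (Fin m) (Fin m) R) (i j l : Fin k) (hij : i ≠ j)
    (hil : i ≠ l) (hjl : j ≠ l)
    (X Y Z : Matrix (Fin m) (Fin m) R) : B3 V i j l X Y Z = B3 V i j l X Z Y := by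
  refine MM_swap j l _ _ ?_ ?_ ?_
  · rw [Function.update_self, Function.update_of_ne hjl.symm, Function.update_of_ne hil.symm,
      Function.update_self]
  · rw [Function.update_self, Function.update_of_ne hjl.symm, Function.update_of_ne hil.symm,
      Function.update_self]
  · intro a h1 h2
    rw [Function.update_of_ne h1, Function.update_of_ne h1]
    by_cases h : a = i
    · subst h; rw [Function.update_self, Function.update_self]
    · rw [Function.update_of_ne h, Function.update_of_ne h, Function.update_of_ne h2,
        Function.update_of_ne h2]

lemma B3_cube (V : Fin k → Matrix (Fin m) (Fin m) R) (i j l : Fin k) (hij : i ≠ j)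
    (hil : i ≠ l) (hjl : j ≠ l) (Y A : Matrix (Fin m) (Fin m) R) (u : R) :
    B3 V i j l (Y + u • A) (Y + u • A) (Y + u • A) =
      B3 V i j l A A A * u ^ 3 + 3 * B3 V i j l Y A A * u ^ 2 + 3 * B3 V i j l Y Y A * u
        + B3 V i j l Y Y Y := by
  have a1 : ∀ X X' Y Z, B3 V i j l (X + X') Y Z = B3 V i j l X Y Z + B3 V i j l X' Y Z :=
    fun X X' Y Z => B2_add_left _ i j hij X X' Y
  have s1 : ∀ X Y Z (s : R), B3 V i j l (s • X) Y Z = s * B3 V i j l X Y Z :=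
    fun X Y Z s => B2_smul_left _ i j hij X Y s
  have a2 : ∀ X Y Y' Z, B3 V i j l X (Y + Y') Z = B3 V i j l X Y Z + B3 V i j l X Y' Z :=
    fun X Y Y' Z => B2_add_right _ i j X Y Y'
  have s2 : ∀ X Y Z (s : R), B3 V i j l X (s • Y) Z = s * B3 V i j l X Y Z :=
    fun X Y Z s => B2_smul_right _ i j X Y s
  have sy := B3_symm V i j l hij
  have sy' := B3_symm' V i j l hij hil hjl
  have a3 : ∀ X Y Z Z', B3 V i j l X Y (Z + Z') = B3 V i j l X Y Z + B3 V i j l X Y Z' := by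
    intro X Y Z Z'
    rw [sy', a2, sy' X Z, sy' X Z']
  have s3 : ∀ X Y Z (s : R), B3 V i j l X Y (s • Z) = s * B3 V i j l X Y Z := by
    intro X Y Z s
    rw [sy', s2, sy' X Z]
  simp only [a1, s1, a2, s2, a3, s3]
  rw [sy' Y A Y, sy A Y Y, sy' Y A Y, sy' A A Y, sy A Y A]
  ring

lemma B2_sq (V : Fin k → Matrix (Fin m) (Fin m) R) (i j : Fin k) (hij : i ≠ j)
    (Y A : Matrix (Fin m) (Fin m) R) (u : R) :
    B2 V i j (Y + u • A) (Y + u • A) =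
      B2 V i j A A * u ^ 2 + 2 * B2 V i j Y A * u + B2 V i j Y Y := by
  simp only [B2_add_left V i j hij, B2_add_right, B2_smul_left V i j hij, B2_smul_right]
  rw [B2_symm V i j hij A Y]
  ring

end forms

lemma MM_cm {m k : ℕ} (V : Fin k → Matrix (Fin m) (Fin m) ℝ) :
    MM m k ℂ (fun a => cm (V a)) = ((MM m k ℝ V : ℝ) : ℂ) := by
  rw [MM_apply, MM_apply]
  exact MR_map Complex.ofRealHom V

lemma cm_update {m k : ℕ} (V : Fin k → Matrix (Fin m) (Fin m) ℝ) (i : Fin k)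
    (X : Matrix (Fin m) (Fin m) ℝ) :
    Function.update (fun a => cm (V a)) i (cm X) = fun a => cm (Function.update V i X a) := by
  funext a
  by_cases h : a = i
  · subst h; rw [Function.update_self, Function.update_self]
  · rw [Function.update_of_ne h, Function.update_of_ne h]

lemma B2_cm {m k : ℕ} (V : Fin k → Matrix (Fin m) (Fin m) ℝ) (i j : Fin k)
    (X Y : Matrix (Fin m) (Fin m) ℝ) :
    B2 (fun a => cm (V a)) i j (cm X) (cm Y) = ((B2 V i j X Y : ℝ) : ℂ) := by
  unfold B2
  rw [cm_update, cm_update, MM_cm]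

lemma B3_cm {m k : ℕ} (V : Fin k → Matrix (Fin m) (Fin m) ℝ) (i j l : Fin k)
    (X Y Z : Matrix (Fin m) (Fin m) ℝ) :
    B3 (fun a => cm (V a)) i j l (cm X) (cm Y) (cm Z) = ((B3 V i j l X Y Z : ℝ) : ℂ) := by
  unfold B3
  rw [cm_update, B2_cm]


lemma B2_ne {m k : ℕ} (hk : k ≤ m) (V : Fin k → Matrix (Fin m) (Fin m) ℝ)
    (hV : ∀ i, (V i).IsSymm) (hg : ∀ i, matGamma k (V i))
    (i j : Fin k) (A X : Matrix (Fin m) (Fin m) ℝ) (hA : A.IsSymm)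
    (hgA : matGamma k A) (hX : X.IsSymm) (u : ℂ) (hu : 0 < u.im) :
    B2 (fun a => cm (V a)) i j (cm X + u • cm A) (cm X + u • cm A) ≠ 0 := by
  have := mixed_ne hk V hV hg ({i, j}ᶜ) (cm X) (HH.real X hX) A hA hgA u hu
  convert this using 1
  unfold B2
  congr 1
  funext a
  by_cases h2 : a = j
  · subst h2; rw [Function.update_self]; simp
  by_cases h1 : a = i
  · subst h1; rw [Function.update_of_ne h2, Function.update_self]; simp
  rw [Function.update_of_ne h2, Function.update_of_ne h1]; simp [h1, h2]

lemma B3_ne {m k : ℕ} (hk : k ≤ m) (V : Fin k → Matrix (Fin m) (Fin m) ℝ)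
    (hV : ∀ i, (V i).IsSymm) (hg : ∀ i, matGamma k (V i))
    (i j l : Fin k) (A X : Matrix (Fin m) (Fin m) ℝ) (hA : A.IsSymm)
    (hgA : matGamma k A) (hX : X.IsSymm) (u : ℂ) (hu : 0 < u.im) :
    B3 (fun a => cm (V a)) i j l (cm X + u • cm A) (cm X + u • cm A) (cm X + u • cm A) ≠ 0 := by
  have := mixed_ne hk V hV hg ({i, j, l}ᶜ) (cm X) (HH.real X hX) A hA hgA u hu
  convert this using 1
  unfold B3 B2
  congr 1
  funext a
  by_cases h2 : a = j
  · subst h2; rw [Function.update_self]; simp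
  by_cases h1 : a = i
  · subst h1; rw [Function.update_of_ne h2, Function.update_self]; simp
  by_cases h3 : a = l
  · subst h3; rw [Function.update_of_ne h2, Function.update_of_ne h1, Function.update_self]; simp
  rw [Function.update_of_ne h2, Function.update_of_ne h1, Function.update_of_ne h3]
  simp [h1, h2, h3]

lemma B2_AA_ne {m k : ℕ} (hk : k ≤ m) (V : Fin k → Matrix (Fin m) (Fin m) ℝ)
    (hV : ∀ i, (V i).IsSymm) (hg : ∀ i, matGamma k (V i))
    (i j : Fin k) (hij : i ≠ j) (A : Matrix (Fin m) (Fin m) ℝ) (hA : A.IsSymm)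
    (hgA : matGamma k A) : B2 V i j A A ≠ 0 := by
  intro h0
  have := B2_ne hk V hV hg i j A 0 hA hgA (by simp [Matrix.IsSymm]) Complex.I (by simp)
  apply this
  have e : cm (0 : Matrix (Fin m) (Fin m) ℝ) + Complex.I • cm A = Complex.I • cm A := by
    simp [cm]
  rw [e, B2_smul_left _ i j hij, B2_smul_right, B2_cm, h0]
  simp

lemma B2_disc {m k : ℕ} (hk : k ≤ m) (V : Fin k → Matrix (Fin m) (Fin m) ℝ)
    (hV : ∀ i, (V i).IsSymm) (hg : ∀ i, matGamma k (V i))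
    (i j : Fin k) (hij : i ≠ j) (A X : Matrix (Fin m) (Fin m) ℝ) (hA : A.IsSymm)
    (hgA : matGamma k A) (hX : X.IsSymm) :
    B2 V i j A A * B2 V i j X X ≤ B2 V i j X A ^ 2 := by
  refine quad_real _ _ _ (B2_AA_ne hk V hV hg i j hij A hA hgA) fun u hu => ?_
  have := B2_ne hk V hV hg i j A X hA hgA hX u hu
  rw [B2_sq _ i j hij, B2_cm, B2_cm, B2_cm] at this
  exact this

lemma B3_AAA_ne {m k : ℕ} (hk : k ≤ m) (V : Fin k → Matrix (Fin m) (Fin m) ℝ)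
    (hV : ∀ i, (V i).IsSymm) (hg : ∀ i, matGamma k (V i))
    (i j l : Fin k) (hij : i ≠ j) (hil : i ≠ l) (hjl : j ≠ l)
    (A : Matrix (Fin m) (Fin m) ℝ) (hA : A.IsSymm)
    (hgA : matGamma k A) : B3 V i j l A A A ≠ 0 := by
  intro h0
  have := B3_ne hk V hV hg i j l A 0 hA hgA (by simp [Matrix.IsSymm]) Complex.I (by simp)
  apply this
  have e0 : cm (0 : Matrix (Fin m) (Fin m) ℝ) = (0 : ℂ) • (1 : Matrix (Fin m) (Fin m) ℂ) := by
    simp [cm]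
  rw [B3_cube _ i j l hij hil hjl, B3_cm, B3_cm, B3_cm, B3_cm, h0]
  have z1 : ∀ Y Z, B3 V i j l 0 Y Z = 0 := by
    intro Y Z
    have := B2_smul_left (Function.update V l Z) i j hij 0 Y (0 : ℝ)
    rw [smul_zero, zero_mul] at this
    exact this
  rw [z1, z1, z1]
  simp

lemma B3_cubic {m k : ℕ} (hk : k ≤ m) (V : Fin k → Matrix (Fin m) (Fin m) ℝ)
    (hV : ∀ i, (V i).IsSymm) (hg : ∀ i, matGamma k (V i))
    (i j l : Fin k) (hij : i ≠ j) (hil : i ≠ l) (hjl : j ≠ l)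
    (A X : Matrix (Fin m) (Fin m) ℝ) (hA : A.IsSymm)
    (hgA : matGamma k A) (hX : X.IsSymm) :
    (B3 V i j l X X X / B3 V i j l A A A) ^ 2 ≤
      (9 * (B3 V i j l X A A / B3 V i j l A A A) ^ 2 -
        6 * (B3 V i j l X X A / B3 V i j l A A A)) ^ 3 := by
  refine cubic_real _ _ _ _ (B3_AAA_ne hk V hV hg i j l hij hil hjl A hA hgA) fun u hu => ?_
  have := B3_ne hk V hV hg i j l A X hA hgA hX u hu
  rw [B3_cube _ i j l hij hil hjl, B3_cm, B3_cm, B3_cm, B3_cm] at this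
  exact this

lemma B2_ker {m k : ℕ} (hk : k ≤ m) (V : Fin k → Matrix (Fin m) (Fin m) ℝ)
    (hV : ∀ i, (V i).IsSymm) (hg : ∀ i, matGamma k (V i))
    (i j : Fin k) (hij : i ≠ j) (A X Y : Matrix (Fin m) (Fin m) ℝ) (hA : A.IsSymm)
    (hgA : matGamma k A) (hX : X.IsSymm) (hY : Y.IsSymm) (h1 : B2 V i j X A = 0)
    (h2 : B2 V i j X X = 0) : B2 V i j X Y = 0 := by
  have ha := B2_AA_ne hk V hV hg i j hij A hA hgA
  have hd : ∀ v : ℝ, B2 V i j A A * (2 * B2 V i j X Y * v + B2 V i j Y Y * v ^ 2) ≤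
      (v * B2 V i j Y A) ^ 2 := by
    intro v
    have := B2_disc hk V hV hg i j hij A (X + v • Y) hA hgA (by
      rw [Matrix.IsSymm, Matrix.transpose_add, Matrix.transpose_smul, hX, hY])
    rw [B2_sq V i j hij, B2_add_left V i j hij, B2_smul_left V i j hij, h1, h2] at this
    linarith
  set a := B2 V i j A A
  set η := B2 V i j X Y
  set ζ := B2 V i j Y Y
  set β := B2 V i j Y A
  by_contra hη
  set g := β ^ 2 - a * ζ with hgd
  set t := 1 / (|g| + 1) with ht
  have htp : 0 < t := by positivity
  have htg : t * g < 1 := by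
    rw [ht, one_div, inv_mul_lt_iff₀ (by positivity)]
    have := le_abs_self g
    linarith
  have h3 := hd (2 * a * η * t)
  have h4 : 0 < (a * η) ^ 2 := by positivity
  have h5 : 4 * (a * η) ^ 2 * t * (1 - t * g) ≤ 0 := by
    rw [hgd]; linarith
  have h6 : 0 < 4 * (a * η) ^ 2 * t * (1 - t * g) := by
    have : 0 < 1 - t * g := by linarith
    positivity
  linarith

lemma B3_zero {m k : ℕ} (hk : k ≤ m) (V : Fin k → Matrix (Fin m) (Fin m) ℝ)
    (hV : ∀ i, (V i).IsSymm) (hg : ∀ i, matGamma k (V i))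
    (i j l : Fin k) (hij : i ≠ j) (hil : i ≠ l) (hjl : j ≠ l)
    (X E : Matrix (Fin m) (Fin m) ℝ) (hX : X.IsSymm) (hE : E.IsSymm)
    (hker : ∀ Y : Matrix (Fin m) (Fin m) ℝ, Y.IsSymm → B2 V i j X Y = 0) :
    B3 V i j l X X E = 0 := by
  have hup : ∀ Y Z, B3 V i j l Y Z (V l) = B2 V i j Y Z := by
    intro Y Z; unfold B3; rw [Function.update_eq_self]
  have ha := B3_AAA_ne hk V hV hg i j l hij hil hjl (V l) (hV l) (hg l)
  refine bdd_quad (B3 V i j l (V l) (V l) (V l)) _ (B3 V i j l X E E)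
    (B3 V i j l E E E) (B3 V i j l X X X)
    ((9 * (B3 V i j l E (V l) (V l) / B3 V i j l (V l) (V l) (V l)) ^ 2 -
        6 * (B3 V i j l E E (V l) / B3 V i j l (V l) (V l) (V l))) ^ 3) ha fun v => ?_
  have h := B3_cubic hk V hV hg i j l hij hil hjl (V l) (E + v • X) (hV l) (hg l) (by
    rw [Matrix.IsSymm, Matrix.transpose_add, Matrix.transpose_smul, hX, hE])
  have e1 : B3 V i j l (E + v • X) (V l) (V l) = B3 V i j l E (V l) (V l) := by
    rw [hup, hup, B2_add_left V i j hij, B2_smul_left V i j hij, hker _ (hV l)]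
    ring
  have e2 : B3 V i j l (E + v • X) (E + v • X) (V l) = B3 V i j l E E (V l) := by
    rw [hup, hup, B2_sq V i j hij, hker X hX, B2_symm V i j hij E X, hker E hE]
    ring
  rw [e1, e2, B3_cube V i j l hij hil hjl] at h
  rw [B3_symm' V i j l hij hil hjl E E X, B3_symm V i j l hij E X E,
    B3_symm V i j l hij E X X, B3_symm' V i j l hij hil hjl X E X] at h
  convert h using 3


/-! ### Definiteness -/

lemma sigmaM_one_pos {m k : ℕ} (hk : k ≤ m) : matGamma k (1 : Matrix (Fin m) (Fin m) ℝ) := by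
  intro j _ hj
  have h := sigmaM_add (0 : Matrix (Fin m) (Fin m) ℝ) 1 0 j (hj.trans hk)
  rw [one_smul, zero_smul, add_zero, Finset.sum_eq_single 0] at h
  · rw [h, sigmaM_zero]
    have : 0 < m.choose j := Nat.choose_pos (hj.trans hk)
    simpa using this
  · intro b _ hb
    rw [zero_pow hb]; ring
  · intro h; simp at h

lemma eval_pdet {m : ℕ} (W : Matrix (Fin m) (Fin m) ℝ) (x : ℝ) :
    ((1 + (Polynomial.X : Polynomial ℝ) • W.map Polynomial.C).det).eval x
      = (1 + x • W).det := by
  rw [← Polynomial.coe_evalRingHom, RingHom.map_det]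
  congr 1
  ext i j
  simp [Matrix.one_apply, apply_ite]
  ring

lemma sym_zero {m : ℕ} (W : Matrix (Fin m) (Fin m) ℝ) (hW : W.IsSymm)
    (h1 : sigmaM 1 W = 0) (h2 : sigmaM 2 W = 0) : W = 0 := by
  set P := ((1 + (Polynomial.X : Polynomial ℝ) • W.map Polynomial.C).det) with hP
  set Q := ((1 + (Polynomial.X : Polynomial ℝ) • (W * W).map Polynomial.C).det) with hQ
  have hPQ : P * P.comp (-Polynomial.X) = Q.comp (-Polynomial.X ^ 2) := by
    apply Polynomial.funext
    intro x
    simp only [Polynomial.eval_mul, Polynomial.eval_comp, Polynomial.eval_neg, Polynomial.eval_X,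
      Polynomial.eval_pow]
    rw [hP, hQ, eval_pdet, eval_pdet, eval_pdet, ← Matrix.det_mul]
    congr 1
    simp only [add_mul, mul_add, one_mul, mul_one, Matrix.smul_mul, Matrix.mul_smul, neg_smul,
      smul_smul, pow_two, mul_neg, neg_mul]
    abel
  have c0 : P.coeff 0 = 1 := sigmaM_zero W
  have hd : (Polynomial.X : Polynomial ℝ) ^ 3 ∣ P - 1 := by
    rw [Polynomial.X_pow_dvd_iff]
    intro d hd
    interval_cases d
    · simp [c0]
    · have : P.coeff 1 = 0 := h1
      simp [this, Polynomial.coeff_one]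
    · have : P.coeff 2 = 0 := h2
      simp [this, Polynomial.coeff_one]
  obtain ⟨S, hS⟩ := hd
  have e0 : Q.coeff 0 = 1 := sigmaM_zero (W * W)
  have e1 : Q.coeff 1 = (W * W).trace := Matrix.coeff_det_one_add_X_smul_one _
  have hd2 : (Polynomial.X : Polynomial ℝ) ^ 2 ∣
      Q - 1 - Polynomial.C (W * W).trace * Polynomial.X := by
    rw [Polynomial.X_pow_dvd_iff]
    intro d hd
    interval_cases d
    · simp [e0]
    · simp [e1, Polynomial.coeff_one]
  obtain ⟨T, hT⟩ := hd2
  have hS' : P = 1 + Polynomial.X ^ 3 * S := by rw [← hS]; ring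
  have hT' : Q = 1 + Polynomial.C (W * W).trace * Polynomial.X + Polynomial.X ^ 2 * T := by
    rw [← hT]; ring
  rw [hS', hT'] at hPQ
  simp only [Polynomial.add_comp, Polynomial.mul_comp, Polynomial.one_comp, Polynomial.pow_comp,
    Polynomial.X_comp, Polynomial.C_comp] at hPQ
  have hdv : (Polynomial.X : Polynomial ℝ) ^ 3 ∣ Polynomial.C (W * W).trace * Polynomial.X ^ 2 := by
    refine ⟨Polynomial.X * T.comp (-Polynomial.X ^ 2) - S + S.comp (-Polynomial.X)
      + Polynomial.X ^ 3 * S * S.comp (-Polynomial.X), ?_⟩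
    linear_combination hPQ
  rw [Polynomial.X_pow_dvd_iff] at hdv
  have ht := hdv 2 (by norm_num)
  rw [Polynomial.coeff_C_mul_X_pow] at ht
  simp only [if_true] at ht
  have : (Wᴴ * W).trace = 0 := by
    rw [Matrix.conjTranspose_eq_transpose_of_trivial, hW.eq]; exact ht
  exact Matrix.trace_conjTranspose_mul_self_eq_zero_iff.1 this

lemma base_zero {m k : ℕ} (hk : k ≤ m) (i j : Fin k) (hij : i ≠ j)
    (X : Matrix (Fin m) (Fin m) ℝ) (hX : X.IsSymm)
    (h1 : B2 (fun _ => 1) i j X 1 = 0) (h2 : B2 (fun _ => 1) i j X X = 0) : X = 0 := by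
  classical
  set F : Finset (Fin k) → ℝ := fun S =>
    MM m k ℝ (S.piecewise (fun _ => X) (fun _ => 1)) with hF
  have hF1 : ∀ S, S.card = 1 → F S = 0 := by
    intro S hS
    obtain ⟨a, rfl⟩ := Finset.card_eq_one.1 hS
    rw [← h1]
    refine MM_swap a i _ _ ?_ ?_ ?_
    · simp [hij]
    · by_cases hai : a = i
      · subst hai; simp [hij]
      · by_cases haj : a = j
        · subst haj; simp [hij]
        · simp [hai, haj, Ne.symm hai, Ne.symm haj]
    · intro b hb1 hb2
      by_cases hbj : b = j
      · subst hbj; simp [hb1]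
      · simp [hb1, hb2, hbj]
  have hF2 : ∀ S, S.card = 2 → F S = 0 := by
    intro S hS
    obtain ⟨a, b, hab, rfl⟩ := Finset.card_eq_two.1 hS
    rw [← h2]
    set π : Equiv.Perm (Fin k) := Equiv.swap (Equiv.swap i a j) b * Equiv.swap i a with hπ
    have hja : Equiv.swap i a j ≠ a := by
      intro h
      have : Equiv.swap i a j = Equiv.swap i a i := by rw [h, Equiv.swap_apply_left]
      exact hij ((Equiv.injective _ this).symm)
    have hpi : π i = a := by
      rw [hπ, Equiv.Perm.mul_apply, Equiv.swap_apply_left,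
        Equiv.swap_apply_of_ne_of_ne hja.symm hab]
    have hpj : π j = b := by
      rw [hπ, Equiv.Perm.mul_apply, Equiv.swap_apply_left]
    simp only [hF, B2]
    rw [MM_apply, MM_apply, ← MR_perm _ π]
    congr 1
    funext c
    by_cases hci : c = i
    · subst hci; rw [hpi]; simp [hij]
    by_cases hcj : c = j
    · subst hcj; rw [hpj]; simp
    have n1 : π c ≠ a := fun h => hci (π.injective (h.trans hpi.symm))
    have n2 : π c ≠ b := fun h => hcj (π.injective (h.trans hpj.symm))
    simp [n1, n2, hci, hcj]
  set P : Polynomial ℝ := ∑ S : Finset (Fin k), Polynomial.C (F S) * Polynomial.X ^ S.card with hP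
  set Q : Polynomial ℝ := ∑ l ∈ Finset.range (k + 1),
    Polynomial.C ((k.factorial : ℝ) * ((m - l).choose (k - l) : ℝ) * sigmaM l X) *
      Polynomial.X ^ l with hQ
  have hPQ : P = Q := by
    apply Polynomial.funext
    intro s
    have hl : P.eval s = MM m k ℝ (fun _ => (1 : ℝ) • 1 + s • X) := by
      have e : (fun _ : Fin k => (1 : ℝ) • (1 : Matrix (Fin m) (Fin m) ℝ) + s • X) =
        (fun _ => s • X) + (fun _ => 1) := by
        funext a; simp [add_comm]
      rw [e, MultilinearMap.map_add_univ, hP, Polynomial.eval_finsetSum]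
      refine Finset.sum_congr rfl fun S _ => ?_
      have e2 : S.piecewise (fun _ : Fin k => s • X) (fun _ => 1) =
        S.piecewise (fun a => s • S.piecewise (fun _ : Fin k => X) (fun _ => 1) a)
          (S.piecewise (fun _ : Fin k => X) (fun _ => 1)) := by
        funext a
        by_cases ha : a ∈ S <;> simp [ha]
      rw [e2, MultilinearMap.map_piecewise_smul (MM m k ℝ) (fun _ => s)]
      rw [Finset.prod_const, smul_eq_mul, Polynomial.eval_mul, Polynomial.eval_C,
        Polynomial.eval_pow, Polynomial.eval_X, mul_comm]
    rw [hl, MM_diag hk, sigmaM_add X 1 s k hk, hQ, Polynomial.eval_finsetSum, Finset.mul_sum]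
    refine Finset.sum_congr rfl fun l _ => ?_
    simp; ring
  have hPc : ∀ d, (∀ S : Finset (Fin k), S.card = d → F S = 0) → P.coeff d = 0 := by
    intro d hd
    rw [hP, Polynomial.finsetSum_coeff]
    refine Finset.sum_eq_zero fun S _ => ?_
    rw [Polynomial.coeff_C_mul_X_pow]
    split_ifs with h
    · exact hd S h.symm
    · rfl
  have hQc : ∀ d, d ≤ k → Q.coeff d = 0 → sigmaM d X = 0 := by
    intro d hd h
    rw [hQ, Polynomial.finsetSum_coeff, Finset.sum_eq_single d] at h
    · rw [Polynomial.coeff_C_mul_X_pow, if_pos rfl] at h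
      have c1 : ((k.factorial : ℝ)) ≠ 0 := by exact_mod_cast k.factorial_ne_zero
      have c2 : ((m - d).choose (k - d) : ℝ) ≠ 0 := by
        exact_mod_cast (Nat.choose_pos (by omega)).ne'
      exact (mul_eq_zero.1 h).resolve_left (mul_ne_zero c1 c2)
    · intro b _ hb
      rw [Polynomial.coeff_C_mul_X_pow, if_neg (Ne.symm hb)]
    · intro h'; exact absurd (Finset.mem_range.2 (by omega)) h'
  have hk2 : 2 ≤ k := by
    have := i.2; have := j.2
    have : (i : ℕ) ≠ j := fun h => hij (Fin.ext h)
    omega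
  exact sym_zero X hX (hQc 1 (by omega) (hPQ ▸ hPc 1 hF1)) (hQc 2 hk2 (hPQ ▸ hPc 2 hF2))

lemma kernel_zero {m k : ℕ} (hk : k ≤ m) (i j : Fin k) (hij : i ≠ j)
    (X : Matrix (Fin m) (Fin m) ℝ) (hX : X.IsSymm) (T : Finset (Fin k)) :
    ∀ (V : Fin k → Matrix (Fin m) (Fin m) ℝ), (∀ i, (V i).IsSymm) → (∀ i, matGamma k (V i)) →
    (∀ l, l ≠ i → l ≠ j → l ∉ T → V l = 1) →
    ∀ A : Matrix (Fin m) (Fin m) ℝ, A.IsSymm → matGamma k A →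
    B2 V i j X A = 0 → B2 V i j X X = 0 → X = 0 := by
  classical
  have hs1 : (1 : Matrix (Fin m) (Fin m) ℝ).IsSymm := Matrix.isSymm_one
  induction T using Finset.induction_on with
  | empty =>
    intro V hV hg h1 A hA hgA e1 e2
    have e3 := B2_ker hk V hV hg i j hij A X 1 hA hgA hX hs1 e1 e2
    have key : ∀ Y, B2 V i j X Y = B2 (fun _ => 1) i j X Y := by
      intro Y
      unfold B2
      congr 1
      funext a
      by_cases haj : a = j
      · subst haj; simp
      by_cases hai : a = i
      · subst hai; simp [haj]
      · simp [haj, hai, h1 a hai haj]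
    rw [key] at e2 e3
    exact base_zero hk i j hij X hX e3 e2
  | insert l T _ ih =>
    intro V hV hg h1 A hA hgA e1 e2
    by_cases hl : l = i ∨ l = j
    · refine ih V hV hg (fun a ha hb hc => h1 a ha hb ?_) A hA hgA e1 e2
      rw [Finset.mem_insert, not_or]
      refine ⟨?_, hc⟩
      rintro rfl
      tauto
    rw [not_or] at hl
    have ker : ∀ Y : Matrix (Fin m) (Fin m) ℝ, Y.IsSymm → B2 V i j X Y = 0 := fun Y hY =>
      B2_ker hk V hV hg i j hij A X Y hA hgA hX hY e1 e2
    refine ih (Function.update V l 1) ?_ ?_ ?_ (V l) (hV l) (hg l) ?_ ?_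
    · intro a
      by_cases h : a = l
      · subst h; rw [Function.update_self]; exact hs1
      · rw [Function.update_of_ne h]; exact hV a
    · intro a
      by_cases h : a = l
      · subst h; rw [Function.update_self]; exact sigmaM_one_pos hk
      · rw [Function.update_of_ne h]; exact hg a
    · intro a ha hb hc
      by_cases h : a = l
      · subst h; rw [Function.update_self]
      · rw [Function.update_of_ne h]
        exact h1 a ha hb (by simp [h, hc])
    · change B3 V i j l X (V l) 1 = 0
      rw [B3_symm' V i j l hij (Ne.symm hl.1) (Ne.symm hl.2)]
      unfold B3
      rw [Function.update_eq_self]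
      exact ker 1 hs1
    · exact B3_zero hk V hV hg i j l hij (Ne.symm hl.1) (Ne.symm hl.2) X 1 hX hs1 ker

lemma main_aux {m k : ℕ} (hk : k ≤ m) (i j : Fin k) (hij : i ≠ j)
    (W : Fin k → Matrix (Fin m) (Fin m) ℝ) (hWs : ∀ i, (W i).IsSymm)
    (hW : ∀ i, matGamma k (W i) ∨ matGamma k (-(W i))) :
    B2 W i j (W i) (W i) * B2 W i j (W j) (W j) ≤ B2 W i j (W i) (W j) ^ 2 ∧
    (B2 W i j (W i) (W j) ^ 2 = B2 W i j (W i) (W i) * B2 W i j (W j) (W j) →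
      ∃ c : ℝ, c ≠ 0 ∧ W j = c • W i) := by
  classical
  have hex : ∀ a, ∃ e : ℝ, e * e = 1 ∧ matGamma k (e • W a) := by
    intro a
    rcases hW a with h | h
    · exact ⟨1, by norm_num, by rwa [one_smul]⟩
    · exact ⟨-1, by norm_num, by rwa [neg_smul, one_smul]⟩
  choose e he hg using hex
  obtain ⟨U, hU⟩ : ∃ U : Fin k → Matrix (Fin m) (Fin m) ℝ, U = fun a => e a • W a := ⟨_, rfl⟩
  replace hg : ∀ a, matGamma k (U a) := by rw [hU]; exact hg
  have hUs : ∀ a, (U a).IsSymm := by rw [hU]; exact fun a => (hWs a).smul _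
  have hWU : ∀ a, W a = e a • U a := by
    intro a; rw [hU]; simp only; rw [smul_smul, he, one_smul]
  set p : ℝ := ∏ a ∈ ({i, j}ᶜ : Finset (Fin k)), e a with hp
  have hpp : p * p = 1 := by
    rw [hp, ← Finset.prod_mul_distrib]; exact Finset.prod_eq_one fun a _ => he a
  have hB : ∀ X Y, B2 W i j X Y = p * B2 U i j X Y := by
    intro X Y
    unfold B2
    have e2 : Function.update (Function.update W i X) j Y =
      ({i, j}ᶜ : Finset (Fin k)).piecewise
        (fun a => e a • (Function.update (Function.update U i X) j Y) a)
        (Function.update (Function.update U i X) j Y) := by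
      funext a
      by_cases haj : a = j
      · subst haj; simp
      by_cases hai : a = i
      · subst hai; simp [haj]
      · simp [haj, hai, ← hWU]
    rw [e2, MultilinearMap.map_piecewise_smul, smul_eq_mul]
  have hL := B2_smul_left U i j hij
  have hR := B2_smul_right U i j
  have x1 : B2 W i j (W i) (W i) * B2 W i j (W j) (W j) = B2 U i j (U i) (U i) * B2 U i j (U j) (U j) := by
    rw [hB, hB, hWU i, hWU j]
    simp only [hL, hR]
    linear_combination (B2 U i j (U i) (U i) * B2 U i j (U j) (U j)) *
      (e i * e i * (e j * e j) * hpp + e i * e i * he j + he i)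
  have x2 : B2 W i j (W i) (W j) ^ 2 = B2 U i j (U j) (U i) ^ 2 := by
    rw [hB, hWU i, hWU j, hL, hR, B2_symm U i j hij (U i) (U j)]
    linear_combination (B2 U i j (U j) (U i) ^ 2) *
      (e i * e i * (e j * e j) * hpp + e i * e i * he j + he i)
  rw [x1, x2]
  refine ⟨B2_disc hk U hUs hg i j hij (U i) (U j) (hUs i) (hg i) (hUs j), fun heq => ?_⟩
  have ha := B2_AA_ne hk U hUs hg i j hij (U i) (hUs i) (hg i)
  set c := B2 U i j (U j) (U i) / B2 U i j (U i) (U i) with hc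
  have hc' : c * B2 U i j (U i) (U i) = B2 U i j (U j) (U i) := by rw [hc]; field_simp
  have hz : U j + (-c) • U i = 0 := by
    refine kernel_zero hk i j hij _ ((hUs j).add ((hUs i).smul _)) Finset.univ U hUs hg
      (fun l _ _ h => absurd (Finset.mem_univ l) h) (U i) (hUs i) (hg i) ?_ ?_
    · rw [B2_add_left U i j hij, hL]
      linear_combination -hc'
    · rw [B2_sq U i j hij]
      apply mul_left_cancel₀ ha
      linear_combination (c * B2 U i j (U i) (U i) - B2 U i j (U j) (U i)) * hc' - heq
  have hUj : U j = c • U i := by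
    rw [neg_smul] at hz
    exact add_neg_eq_zero.1 hz
  have hc0 : c ≠ 0 := by
    intro h
    have hk1 : 1 ≤ k := by have := i.2; omega
    have h1 := hg j 1 le_rfl hk1
    have h2 : sigmaM 1 (U j) = 0 := by
      rw [hUj, h, sigmaM_smul _ _ _ (hk1.trans hk)]; ring
    exact absurd h1 (by rw [h2]; exact lt_irrefl _)
  refine ⟨e j * c * e i, ?_, ?_⟩
  · have n : ∀ a, e a ≠ 0 := fun a h => by have := he a; rw [h] at this; norm_num at this
    exact mul_ne_zero (mul_ne_zero (n j) hc0) (n i)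
  · rw [hWU j, hUj, hU]; simp only [smul_smul]; congr 1; ring

/-- Gårding's inequality for the complete polarization `σ_{(k)}`:
`σ_{(k)}(W¹,W²,W³,…)² ≥ σ_{(k)}(W¹,W¹,W³,…)·σ_{(k)}(W²,W²,W³,…)` whenever each `W^i`
lies in `Γ_k` or `−Γ_k`, with equality iff `W² = c·W¹` for some `c ≠ 0`. -/
theorem statement5 (n k : ℕ) (hn : 3 ≤ n) (hk2 : 2 ≤ k) (hk : k ≤ n - 1)
    (W : Fin k → Matrix (Fin (n-1)) (Fin (n-1)) ℝ) (hWs : ∀ i, (W i).IsSymm)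
    (hW : ∀ i, matGamma k (W i) ∨ matGamma k (-(W i))) :
    polarMat W ^ 2 ≥
      polarMat (Function.update W ⟨1, by omega⟩ (W ⟨0, by omega⟩)) *
        polarMat (Function.update W ⟨0, by omega⟩ (W ⟨1, by omega⟩)) ∧
    (polarMat W ^ 2 =
        polarMat (Function.update W ⟨1, by omega⟩ (W ⟨0, by omega⟩)) *
          polarMat (Function.update W ⟨0, by omega⟩ (W ⟨1, by omega⟩)) ↔
      ∃ c : ℝ, c ≠ 0 ∧ W ⟨1, by omega⟩ = c • W ⟨0, by omega⟩) := by

  have hij : (⟨0, by omega⟩ : Fin k) ≠ ⟨1, by omega⟩ := by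
    intro h; simpa using congrArg Fin.val h
  have hm := main_aux hk ⟨0, by omega⟩ ⟨1, by omega⟩ hij W hWs hW
  have hf : ((1 : ℝ) / (k.factorial : ℝ)) ≠ 0 := by
    have : (k.factorial : ℝ) ≠ 0 := by exact_mod_cast k.factorial_ne_zero
    exact one_div_ne_zero this
  have g0 : MM (n-1) k ℝ W = B2 W ⟨0, by omega⟩ ⟨1, by omega⟩ (W ⟨0, by omega⟩) (W ⟨1, by omega⟩) := by
    unfold B2
    rw [Function.update_eq_self, Function.update_eq_self]
  have g1 : MM (n-1) k ℝ (Function.update W ⟨1, by omega⟩ (W ⟨0, by omega⟩)) =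
      B2 W ⟨0, by omega⟩ ⟨1, by omega⟩ (W ⟨0, by omega⟩) (W ⟨0, by omega⟩) := by
    unfold B2
    rw [Function.update_eq_self]
  have g2 : MM (n-1) k ℝ (Function.update W ⟨0, by omega⟩ (W ⟨1, by omega⟩)) =
      B2 W ⟨0, by omega⟩ ⟨1, by omega⟩ (W ⟨1, by omega⟩) (W ⟨1, by omega⟩) := by
    unfold B2
    congr 1
    funext a
    by_cases ha : a = ⟨1, by omega⟩
    · subst ha; rw [Function.update_self, Function.update_of_ne hij.symm]
    · rw [Function.update_of_ne ha]
  rw [polarMat_eq, polarMat_eq, polarMat_eq, g0, g1, g2]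
  have hL := B2_smul_left W (⟨0, by omega⟩ : Fin k) ⟨1, by omega⟩ hij
  have hR := B2_smul_right W (⟨0, by omega⟩ : Fin k) ⟨1, by omega⟩
  set q := (1 : ℝ) / (k.factorial : ℝ) with hq
  refine ⟨?_, ?_, ?_⟩
  · have := mul_le_mul_of_nonneg_left hm.1 (sq_nonneg q)
    nlinarith
  · intro h
    apply hm.2
    apply mul_left_cancel₀ (pow_ne_zero 2 hf)
    linear_combination h
  · rintro ⟨c, _, hc⟩
    rw [hc, hL, hR]
    ring
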